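/- Let S be a set of N points in the plane in general position whose convex hull is a triangle (exactly 3 convex-hull vertices), and let T be a triangulation of S. Then the number of flippable edges of T satisfies flip(T) ≥ N − 3 − v3(T). -/

import Mathlib

open scoped Classical

noncomputable section

/-- Points of the plane. -/
abbrev Pt : Type := ℝ × ℝ

/-- A finite point set is in general position if no three of its points are collinear. -/
def GenPos (S : Finset Pt) : Prop :=
  ∀ p ∈ S, ∀ q ∈ S, ∀ r ∈ S, p ≠ q → p ≠ r → q ≠ r →
    ¬ Collinear ℝ ({p, q, r} : Set Pt)

/-- The closed straight segment spanned by an unordered pair of points. -/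
def seg2 (e : Sym2 Pt) : Set Pt :=
  Sym2.lift ⟨fun p q => segment ℝ p q, fun p q => segment_symm ℝ p q⟩ e

/-- A crossing-free straight-edge graph (plane graph) on the point set `S`:
its edges are straight segments between points of `S`, any two of which
meet only at shared endpoints. -/
structure PlaneGraph (S : Finset Pt) where
  edges : Finset (Sym2 Pt)
  endpoint_mem : ∀ e ∈ edges, ∀ p, p ∈ e → p ∈ S
  not_isDiag : ∀ e ∈ edges, ¬ e.IsDiag
  noncrossing : ∀ e₁ ∈ edges, ∀ e₂ ∈ edges, e₁ ≠ e₂ →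
    ∀ x ∈ seg2 e₁ ∩ seg2 e₂, x ∈ e₁ ∧ x ∈ e₂

/-- A triangulation of `S` is a maximal plane graph on `S`. -/
def IsTriangulation {S : Finset Pt} (T : PlaneGraph S) : Prop :=
  ∀ G : PlaneGraph S, T.edges ⊆ G.edges → G.edges = T.edges

/-- `tr S`: the number of triangulations of `S`. -/
def triCount (S : Finset Pt) : ℕ :=
  Nat.card {T : PlaneGraph S // IsTriangulation T}

/-- A plane graph is a spanning cycle of `S` if its edges form a Hamiltonian
cycle on `S`. -/
def IsSpanningCycle {S : Finset Pt} (G : PlaneGraph S) : Prop :=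
  3 ≤ S.card ∧ ∃ f : Fin S.card ≃ {p : Pt // p ∈ S},
    G.edges =
      Finset.image (fun i : Fin S.card => s(((f i : Pt)), ((f (finRotate S.card i) : Pt)))) Finset.univ

/-- `sc S`: the number of crossing-free straight-edge spanning cycles of `S`. -/
def scCount (S : Finset Pt) : ℕ :=
  Nat.card {G : PlaneGraph S // IsSpanningCycle G}

/-- A plane graph is a perfect matching of `S` if every point of `S` is incident
to exactly one edge. -/
def IsPerfectMatching {S : Finset Pt} (G : PlaneGraph S) : Prop :=
  ∀ p ∈ S, ∃! e, e ∈ G.edges ∧ p ∈ e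

/-- `pm S`: the number of crossing-free straight-edge perfect matchings of `S`. -/
def pmCount (S : Finset Pt) : ℕ :=
  Nat.card {G : PlaneGraph S // IsPerfectMatching G}

/-- The support of a plane graph `G` on `S`: the number of triangulations of `S`
containing all edges of `G`. -/
def supp {S : Finset Pt} (G : PlaneGraph S) : ℕ :=
  Nat.card {T : PlaneGraph S // IsTriangulation T ∧ G.edges ⊆ T.edges}

/-- A finite set of points is in (strictly) convex position. -/
def InConvexPosition (Q : Finset Pt) : Prop :=
  ∀ p ∈ Q, p ∉ convexHull ℝ (↑(Q.erase p) : Set Pt)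

/-- `p q` is an edge of the convex hull boundary of `Q`. -/
def IsHullEdgeOf (Q : Finset Pt) (p q : Pt) : Prop :=
  p ∈ Q ∧ q ∈ Q ∧ p ≠ q ∧
    segment ℝ p q ⊆ frontier (convexHull ℝ (Q : Set Pt))

/-- `e` is a diagonal of the convex polygon with vertex set `Q`. -/
def IsDiagonalOf (Q : Finset Pt) (e : Sym2 Pt) : Prop :=
  ∃ p ∈ Q, ∃ q ∈ Q, e = s(p, q) ∧
    openSegment ℝ p q ⊆ interior (convexHull ℝ (Q : Set Pt))

/-- `F` is a set of ps-flippable (pseudo-simultaneously flippable) edges of the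
triangulation `T`: the edges of `F` are diagonals of pairwise interior-disjoint
(empty) convex polygons whose boundary edges all belong to `T`. -/
def IsPsFlippable {S : Finset Pt} (T : PlaneGraph S) (F : Finset (Sym2 Pt)) : Prop :=
  F ⊆ T.edges ∧
  ∃ 𝒬 : Finset (Finset Pt),
    (∀ Q ∈ 𝒬, ↑Q ⊆ (S : Set Pt) ∧ 3 ≤ Q.card ∧ InConvexPosition Q ∧
      (∀ p q, IsHullEdgeOf Q p q → s(p, q) ∈ T.edges) ∧
      (∀ p ∈ S, p ∉ interior (convexHull ℝ (Q : Set Pt)))) ∧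
    (∀ Q ∈ 𝒬, ∀ Q' ∈ 𝒬, Q ≠ Q' →
      interior (convexHull ℝ (Q : Set Pt)) ∩ interior (convexHull ℝ (Q' : Set Pt)) = ∅) ∧
    (∀ e ∈ F, ∃ Q ∈ 𝒬, IsDiagonalOf Q e)

/-- The drawing of a plane graph: the union of its (closed) edge segments and
its vertex set. -/
def drawing {S : Finset Pt} (G : PlaneGraph S) : Set Pt :=
  (⋃ e ∈ G.edges, seg2 e) ∪ (S : Set Pt)

/-- A convex decomposition of `S`: a plane graph containing all convex hull
boundary edges, whose bounded faces are all convex, and with no isolated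
vertices. -/
def IsConvexDecomposition {S : Finset Pt} (D : PlaneGraph S) : Prop :=
  (∀ p q, IsHullEdgeOf S p q → s(p, q) ∈ D.edges) ∧
  (∀ x ∉ drawing D, Bornology.IsBounded (connectedComponentIn (drawing D)ᶜ x) →
    Convex ℝ (connectedComponentIn (drawing D)ᶜ x)) ∧
  (∀ p ∈ S, ∃ e ∈ D.edges, p ∈ e)

/-- `p` is an interior vertex of `S` (not on the convex hull boundary). -/
def InteriorVtx (S : Finset Pt) (p : Pt) : Prop :=
  p ∈ S ∧ p ∉ frontier (convexHull ℝ (S : Set Pt))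

/-- `p` has a valid triple of edges in `G`. -/
def IsValidAt {S : Finset Pt} (G : PlaneGraph S) (p : Pt) : Prop :=
  ∃ a ∈ S, ∃ b ∈ S, ∃ c ∈ S,
    p ∈ convexHull ℝ ({a, b, c} : Set Pt) ∧
    s(p, a) ∈ G.edges ∧ s(p, b) ∈ G.edges ∧ s(p, c) ∈ G.edges

/-- The degree of a point in a plane graph. -/
def degree {S : Finset Pt} (G : PlaneGraph S) (p : Pt) : ℕ :=
  (G.edges.filter (fun e => p ∈ e)).card

/-- `a b c` span a triangular face of the triangulation `T`. -/
def IsTriFace {S : Finset Pt} (T : PlaneGraph S) (a b c : Pt) : Prop :=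
  a ∈ S ∧ b ∈ S ∧ c ∈ S ∧
  s(a, b) ∈ T.edges ∧ s(b, c) ∈ T.edges ∧ s(a, c) ∈ T.edges ∧
  ∀ p ∈ S, p ∉ interior (convexHull ℝ ({a, b, c} : Set Pt))

/-- An edge of a triangulation is flippable if its two incident triangles form
a convex quadrilateral. -/
def IsFlippable {S : Finset Pt} (T : PlaneGraph S) (e : Sym2 Pt) : Prop :=
  e ∈ T.edges ∧ ∃ a b c d : Pt, e = s(a, b) ∧ c ≠ d ∧
    IsTriFace T a b c ∧ IsTriFace T a b d ∧
    (openSegment ℝ a b ∩ openSegment ℝ c d).Nonempty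

/-- `flip T`: the number of flippable edges of `T`. -/
def flipCount {S : Finset Pt} (T : PlaneGraph S) : ℕ :=
  (T.edges.filter (fun e => IsFlippable T e)).card

/-- `v3 T`: the number of interior vertices of degree 3 in `T`. -/
def v3 {S : Finset Pt} (T : PlaneGraph S) : ℕ :=
  (S.filter (fun p => p ∉ frontier (convexHull ℝ (S : Set Pt)) ∧ degree T p = 3)).card

/-- The number of vertices of `S` on its convex hull boundary. -/
def hullVtxCount (S : Finset Pt) : ℕ :=
  (S.filter (fun p => p ∈ frontier (convexHull ℝ (S : Set Pt)))).card

/-- Orientation determinant. -/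
def ori (a b c : Pt) : ℝ := (b.1 - a.1) * (c.2 - a.2) - (b.2 - a.2) * (c.1 - a.1)

lemma ori_rot (a b c : Pt) : ori a b c = ori b c a := by unfold ori; ring
lemma ori_swap (a b c : Pt) : ori a b c = - ori b a c := by unfold ori; ring
lemma ori_swap' (a b c : Pt) : ori a b c = - ori a c b := by unfold ori; ring
lemma ori_self1 (a b : Pt) : ori a b a = 0 := by unfold ori; ring
lemma ori_self2 (a b : Pt) : ori a b b = 0 := by unfold ori; ring
lemma ori_self3 (a b : Pt) : ori a a b = 0 := by unfold ori; ring

lemma ori_bary (a b c y z r : Pt) : ori a b c * ori y z r =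
    ori b c r * ori y z a + ori c a r * ori y z b + ori a b r * ori y z c := by
  unfold ori; ring

lemma ori_pl (p w u y z : Pt) : ori p y z * ori p w u =
    ori p y u * ori p w z - ori p w y * ori p z u := by
  unfold ori; ring

lemma ori_comb (p q a b : Pt) (t : ℝ) :
    ori p q ((1 - t) • a + t • b) = (1 - t) * ori p q a + t * ori p q b := by
  simp only [ori, Prod.fst_add, Prod.snd_add, Prod.smul_fst, Prod.smul_snd, smul_eq_mul]; ring

/-- The segments `ab` and `cd` cross properly. -/
def Cr (a b c d : Pt) : Prop := ori a b c * ori a b d < 0 ∧ ori c d a * ori c d b < 0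

lemma Cr.symm {a b c d : Pt} (h : Cr a b c d) : Cr c d a b := ⟨h.2, h.1⟩

lemma Cr.swap_right {a b c d : Pt} (h : Cr a b c d) : Cr a b d c := by
  refine ⟨by rw [mul_comm]; exact h.1, ?_⟩
  rw [ori_swap d c a, ori_swap d c b]; linarith [h.2, neg_mul_neg (ori c d a) (ori c d b)]

lemma frac_of_opp {x y : ℝ} (h : x * y < 0) : 0 < x / (x - y) ∧ x / (x - y) < 1 := by
  rcases mul_neg_iff.1 h with ⟨h1, h2⟩ | ⟨h1, h2⟩
  · have : 0 < x - y := by linarith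
    exact ⟨div_pos h1 this, by rw [div_lt_one this]; linarith⟩
  · have : x - y < 0 := by linarith
    exact ⟨div_pos_of_neg_of_neg h1 this, by rw [div_lt_one_of_neg this]; linarith⟩

lemma opp_ne {x y : ℝ} (h : x * y < 0) : x - y ≠ 0 := by
  intro h0
  have : x = y := by linarith
  subst this; nlinarith [mul_self_nonneg x]

lemma Cr.pt {a b c d : Pt} (h : Cr a b c d) : ∃ l t : ℝ, 0 < l ∧ l < 1 ∧ 0 < t ∧ t < 1 ∧
    (1 - l) • a + l • b = (1 - t) • c + t • d := by
  obtain ⟨h1, h2⟩ := h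
  have e1 := opp_ne h1
  have e2 := opp_ne h2
  refine ⟨ori c d a / (ori c d a - ori c d b), ori a b c / (ori a b c - ori a b d),
    (frac_of_opp h2).1, (frac_of_opp h2).2, (frac_of_opp h1).1, (frac_of_opp h1).2, ?_⟩
  have hl : ∃ l, l = ori c d a / (ori c d a - ori c d b) := ⟨_, rfl⟩
  have ht : ∃ t, t = ori a b c / (ori a b c - ori a b d) := ⟨_, rfl⟩
  obtain ⟨l, hl⟩ := hl
  obtain ⟨t, ht⟩ := ht
  rw [← hl, ← ht]
  rw [eq_div_iff e2] at hl
  rw [eq_div_iff e1] at ht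
  have k : ori c d a - ori c d b = -(ori a b c - ori a b d) := by unfold ori; ring
  rw [k] at hl
  ext
  · simp only [Prod.fst_add, Prod.smul_fst, smul_eq_mul]
    apply mul_left_cancel₀ e1
    have : (ori a b c - ori a b d) * a.1 + (-ori c d a) * (b.1 - a.1)
      = (ori a b c - ori a b d) * c.1 + ori a b c * (d.1 - c.1) := by unfold ori; ring
    linear_combination this - (b.1 - a.1) * hl - (d.1 - c.1) * ht
  · simp only [Prod.snd_add, Prod.smul_snd, smul_eq_mul]
    apply mul_left_cancel₀ e1
    have : (ori a b c - ori a b d) * a.2 + (-ori c d a) * (b.2 - a.2)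
      = (ori a b c - ori a b d) * c.2 + ori a b c * (d.2 - c.2) := by unfold ori; ring
    linear_combination this - (b.2 - a.2) * hl - (d.2 - c.2) * ht

/-- Combinatorial properties of a triangulation. -/
structure TG (S : Finset Pt) (adj : Pt → Pt → Prop) : Prop where
  gp : ∀ a ∈ S, ∀ b ∈ S, ∀ c ∈ S, a ≠ b → a ≠ c → b ≠ c → ori a b c ≠ 0
  symm : ∀ {a b}, adj a b → adj b a
  ne : ∀ {a b}, adj a b → a ≠ b
  mem : ∀ {a b}, adj a b → a ∈ S
  nc : ∀ {a b c d}, adj a b → adj c d → ¬ Cr a b c d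
  mx : ∀ a ∈ S, ∀ b ∈ S, a ≠ b → (∀ c d, adj c d → ¬ Cr a b c d) → adj a b

lemma TG.mem' {S adj} (h : TG S adj) {a b} (hab : adj a b) : b ∈ S := h.mem (h.symm hab)

/-- first point in angular order around `a` starting from direction `b` -/
lemma exists_first (s : ℝ) (a b : Pt) (X : Finset Pt) (hX : X.Nonempty)
    (hpos : ∀ x ∈ X, 0 < s * ori a b x) : ∃ c ∈ X, ∀ d ∈ X, s * ori a d c ≤ 0 := by
  obtain ⟨c, hc, hmax⟩ := X.exists_max_image
    (fun x => ((x.1 - a.1) * (b.1 - a.1) + (x.2 - a.2) * (b.2 - a.2)) / (s * ori a b x)) hX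
  refine ⟨c, hc, fun d hd => ?_⟩
  have h := hmax d hd
  have pc := hpos c hc
  have pd := hpos d hd
  rw [div_le_div_iff₀ pd pc] at h
  have hn : 0 < (b.1 - a.1)^2 + (b.2 - a.2)^2 := by
    by_contra hcon
    have h1 : b.1 - a.1 = 0 := by nlinarith [sq_nonneg (b.1 - a.1), sq_nonneg (b.2 - a.2)]
    have h2 : b.2 - a.2 = 0 := by nlinarith [sq_nonneg (b.1 - a.1), sq_nonneg (b.2 - a.2)]
    unfold ori at pc; rw [h1, h2] at pc; simp at pc
  have id : s * ori a d c * ((b.1 - a.1)^2 + (b.2 - a.2)^2) =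
    ((d.1 - a.1) * (b.1 - a.1) + (d.2 - a.2) * (b.2 - a.2)) * (s * ori a b c) -
    ((c.1 - a.1) * (b.1 - a.1) + (c.2 - a.2) * (b.2 - a.2)) * (s * ori a b d) := by
    unfold ori; ring
  by_contra hcon
  push Not at hcon
  have := mul_pos hcon hn
  linarith

/-- If `y` and `u*P+v*Q=0` with `u,v>0` and `P≠0` then `P*Q<0`. -/
lemma opp_of_comb {u v P Q : ℝ} (hu : 0 < u) (hv : 0 < v) (h : u * P + v * Q = 0) (hP : P ≠ 0) :
    P * Q < 0 := by
  have : v * (P * Q) = - (u * P ^ 2) := by linear_combination P * h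
  have h2 : 0 < u * P ^ 2 := by positivity
  by_contra hc
  push Not at hc
  have := mul_nonneg hv.le hc
  linarith

lemma TG.ex_half {S adj} (T : TG S adj) (s : ℝ) (a b c y z x : Pt) (t : ℝ)
    (hO : 0 < s * ori a b c) (hab : adj a b) (hyz : adj y z) (ht0 : 0 < t) (ht1 : t < 1)
    (hx : x = (1 - t) • y + t • z) (h1 : 0 < s * ori a b x) (h3 : 0 ≤ s * ori b c x)
    (hza : z ≠ a) (hP : s * ori a b z < 0) (h3z : 0 < s * ori b c z)
    (hK : 0 < (s * ori a b x) * (s * ori c a z) - (s * ori a b z) * (s * ori c a x)) : False := by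
  have e1 : ori a b x = (1 - t) * ori a b y + t * ori a b z := by rw [hx, ori_comb]
  have e2 : ori y z x = 0 := by rw [hx, ori_comb, ori_self1, ori_self2]; ring
  have hy : 0 < s * ori a b y := by
    have : s * ori a b x = (1 - t) * (s * ori a b y) + t * (s * ori a b z) := by rw [e1]; ring
    by_contra hc
    push Not at hc
    nlinarith
  have hya : y ≠ a := by rintro rfl; rw [ori_self1] at hy; simp at hy
  have hYa : ori y z a ≠ 0 := T.gp _ (T.mem hyz) _ (T.mem' hyz) _ (T.mem hab) (T.ne hyz) hya hza
  have hs : 0 < s ^ 2 := by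
    have : s ≠ 0 := by rintro rfl; simp at hy
    positivity
  refine T.nc hab hyz ⟨?_, ?_⟩
  · have : s ^ 2 * (ori a b y * ori a b z) < 0 := by nlinarith
    by_contra hc
    push Not at hc
    have := mul_nonneg hs.le hc
    linarith
  · refine opp_of_comb (u := -(s * ori a b z) * (s * ori b c x) + (s * ori a b x) * (s * ori b c z))
      ?_ hK ?_ hYa
    · have := mul_pos h1 h3z
      have := mul_nonneg (neg_nonneg.2 hP.le) h3
      linarith
    · have b1 := ori_bary a b c y z x
      have b2 := ori_bary a b c y z z
      rw [e2] at b1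
      rw [ori_self2] at b2
      linear_combination (s^2 * ori a b z) * b1 - (s^2 * ori a b x) * b2

lemma TG.ex {S adj} (T : TG S adj) (a b c y z x : Pt) (t : ℝ)
    (hO : 0 < ori a b c) (hab : adj a b) (hac : adj a c) (hyz : adj y z) (ht0 : 0 < t) (ht1 : t < 1)
    (hx : x = (1 - t) • y + t • z) (h1 : 0 < ori a b x) (h2 : 0 < ori c a x) (h3 : 0 ≤ ori b c x)
    (hza : z ≠ a) (hn : ¬ (0 < ori a b z ∧ 0 < ori c a z)) (h3z : 0 < ori b c z) : False := by
  have hzb : z ≠ b := by rintro rfl; rw [ori_self1] at h3z; simp at h3z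
  have hzc : z ≠ c := by rintro rfl; rw [ori_self2] at h3z; simp at h3z
  have hP : ori a b z ≠ 0 :=
    T.gp _ (T.mem hab) _ (T.mem' hab) _ (T.mem' hyz) (T.ne hab) hza.symm hzb.symm
  have hQ : ori c a z ≠ 0 :=
    T.gp _ (T.mem' hac) _ (T.mem hac) _ (T.mem' hyz) (T.ne hac).symm hzc.symm hza.symm
  have H1 : ori a b z < 0 → 0 < ori a b x * ori c a z - ori a b z * ori c a x → False := by
    intro p k
    refine T.ex_half 1 a b c y z x t ?_ hab hyz ht0 ht1 hx ?_ ?_ hza ?_ ?_ ?_ <;>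
      simpa only [one_mul]
  have H2 : ori c a z < 0 → 0 < ori c a x * ori a b z - ori c a z * ori a b x → False := by
    intro p k
    have f1 : ∀ q, -1 * ori a c q = ori c a q := fun q => by rw [ori_swap c a]; ring
    have f2 : ∀ q, -1 * ori c b q = ori b c q := fun q => by rw [ori_swap b c]; ring
    have f3 : ∀ q, -1 * ori b a q = ori a b q := fun q => by rw [ori_swap a b]; ring
    have f4 : -1 * ori a c b = ori a b c := by rw [ori_swap' a b c]; ring
    refine T.ex_half (-1) a c b y z x t ?_ hac hyz ht0 ht1 hx ?_ ?_ hza ?_ ?_ ?_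
    · rw [f4]; exact hO
    all_goals simpa only [f1, f2, f3]
  rcases lt_or_gt_of_ne hP with p | p
  · rcases lt_trichotomy (ori a b x * ori c a z - ori a b z * ori c a x) 0 with k | k | k
    · have q : ori c a z < 0 := by
        by_contra q
        push Not at q
        nlinarith [mul_nonneg h1.le q, mul_pos (neg_pos.2 p) h2]
      exact H2 q (by linarith)
    · have e2 : ori y z x = 0 := by rw [hx, ori_comb, ori_self1, ori_self2]; ring
      have hya : y ≠ a := by
        rintro rfl
        rw [hx, ori_comb, ori_self1] at h1
        nlinarith
      have hYa : ori y z a ≠ 0 :=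
        T.gp _ (T.mem hyz) _ (T.mem' hyz) _ (T.mem hab) (T.ne hyz) hya hza
      have b1 := ori_bary a b c y z x
      have b2 := ori_bary a b c y z z
      rw [e2] at b1
      rw [ori_self2] at b2
      have : (-(ori a b z) * (ori b c x) + (ori a b x) * (ori b c z)) * ori y z a = 0 := by
        linear_combination (ori a b z) * b1 - (ori a b x) * b2 - k * ori y z b
      rcases mul_eq_zero.1 this with h | h
      · nlinarith [mul_pos h1 h3z, mul_nonneg (neg_nonneg.2 p.le) h3]
      · exact hYa h
    · exact H1 p k
  · have q : ori c a z < 0 := by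
      rcases lt_or_gt_of_ne hQ with q | q
      · exact q
      · exact absurd ⟨p, q⟩ hn
    exact H2 q (by nlinarith [mul_pos h2 p, mul_pos (neg_pos.2 q) h1])
/-- `abc` is a positively oriented empty triangle of the graph. -/
def Fc (S : Finset Pt) (adj : Pt → Pt → Prop) (a b c : Pt) : Prop :=
  0 < ori a b c ∧ adj a b ∧ adj b c ∧ adj c a ∧
    ∀ p ∈ S, ¬ (0 < ori a b p ∧ 0 < ori b c p ∧ 0 < ori c a p)

lemma ori_sum (a b c p : Pt) : ori a b c = ori a b p + ori b c p + ori c a p := by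
  unfold ori; ring

lemma TG.face_of_next {S adj} (T : TG S adj) (a b c : Pt) (hab : adj a b) (hac : adj a c)
    (hO : 0 < ori a b c) (hnext : ∀ d, adj a d → 0 < ori a b d → 0 < ori c a d → False) :
    Fc S adj a b c := by
  have haS := T.mem hab
  have hbS := T.mem' hab
  have hcS := T.mem' hac
  have hempty : ∀ p ∈ S, ¬ (0 < ori a b p ∧ 0 < ori b c p ∧ 0 < ori c a p) := by
    intro p0 hp0 hin0
    obtain ⟨p, hp, hmax⟩ := (S.filter
      (fun p => 0 < ori a b p ∧ 0 < ori b c p ∧ 0 < ori c a p)).exists_max_image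
      (fun p => ori b c p) ⟨p0, by simp only [Finset.mem_filter]; exact ⟨hp0, hin0⟩⟩
    simp only [Finset.mem_filter] at hp hmax
    obtain ⟨hpS, p1, p2, p3⟩ := hp
    have hap : a ≠ p := by rintro rfl; rw [ori_self1] at p1; simp at p1
    refine hnext p (T.mx a haS p hpS hap ?_) p1 p3
    intro y z hyz hcr
    obtain ⟨l, t, hl0, hl1, ht0, ht1, hx⟩ := hcr.pt
    obtain ⟨x, hxe⟩ : ∃ x, x = (1 - l) • a + l • p := ⟨_, rfl⟩
    have x1 : 0 < ori a b x := by
      rw [hxe, ori_comb, ori_self1]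
      have := mul_pos hl0 p1
      linarith
    have x3 : 0 < ori c a x := by
      rw [hxe, ori_comb, ori_self2]
      have := mul_pos hl0 p3
      linarith
    have x2 : ori b c p < ori b c x := by
      rw [hxe, ori_comb, ← ori_rot a b c]
      have := ori_sum a b c p
      nlinarith
    have key : ∀ (y z : Pt) (t : ℝ), adj y z → 0 < t → t < 1 → x = (1 - t) • y + t • z → z ≠ a →
        ori b c x ≤ ori b c z → False := by
      intro y z t hyz ht0 ht1 hx hza hz
      refine T.ex a b c y z x t hO hab hac hyz ht0 ht1 hx x1 x3 (by linarith) hza ?_ (by linarith)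
      rintro ⟨z1, z3⟩
      have := hmax z ⟨T.mem' hyz, z1, by linarith, z3⟩
      linarith
    have hxe2 : x = (1 - t) • y + t • z := by rw [hxe, hx]
    have hza : z ≠ a := by rintro rfl; have := hcr.1; rw [ori_self1] at this; simp at this
    have hya : y ≠ a := by rintro rfl; have := hcr.1; rw [ori_self1] at this; simp at this
    by_cases hz : ori b c x ≤ ori b c z
    · exact key y z t hyz ht0 ht1 hxe2 hza hz
    · refine key z y (1 - t) (T.symm hyz) (by linarith) (by linarith) ?_ hya ?_
      · rw [hxe2]; simp [add_comm]
      · have : ori b c x = (1 - t) * ori b c y + t * ori b c z := by rw [hxe2, ori_comb]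
        push Not at hz
        nlinarith
  refine ⟨hO, hab, ?_, T.symm hac, hempty⟩
  have hbc : b ≠ c := by rintro rfl; rw [ori_self2] at hO; simp at hO
  refine T.mx b hbS c hcS hbc ?_
  intro y z hyz hcr
  obtain ⟨l, t, hl0, hl1, ht0, ht1, hx⟩ := hcr.pt
  obtain ⟨x, hxe⟩ : ∃ x, x = (1 - l) • b + l • c := ⟨_, rfl⟩
  have x1 : 0 < ori a b x := by
    rw [hxe, ori_comb, ori_self2]
    have := mul_pos hl0 hO
    linarith
  have x3 : 0 < ori c a x := by
    rw [hxe, ori_comb, ori_self1, ← ori_rot b c a, ← ori_rot a b c]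
    have := mul_pos (sub_pos.2 hl1) hO
    linarith
  have x2 : ori b c x = 0 := by rw [hxe, ori_comb, ori_self1, ori_self2]; ring
  have key : ∀ (y z : Pt) (t : ℝ), adj y z → 0 < t → t < 1 → x = (1 - t) • y + t • z →
      0 < ori b c z → False := by
    intro y z t hyz ht0 ht1 hx hz
    refine T.ex a b c y z x t hO hab hac hyz ht0 ht1 hx x1 x3 x2.ge ?_ ?_ hz
    · rintro rfl
      refine hnext y (T.symm hyz) ?_ ?_
      · rw [hx, ori_comb, ori_self1] at x1
        by_contra hc
        push Not at hc
        nlinarith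
      · rw [hx, ori_comb, ori_self2] at x3
        by_contra hc
        push Not at hc
        nlinarith
    · rintro ⟨z1, z3⟩
      exact hempty z (T.mem' hyz) ⟨z1, hz, z3⟩
  have hxe2 : x = (1 - t) • y + t • z := by rw [hxe, hx]
  rcases mul_neg_iff.1 hcr.1 with ⟨h1, h2⟩ | ⟨h1, h2⟩
  · exact key z y (1 - t) (T.symm hyz) (by linarith) (by linarith)
      (by rw [hxe2]; simp [add_comm]) h1
  · exact key y z t hyz ht0 ht1 hxe2 h2

set_option maxHeartbeats 1000000 in
/-- Main step of the visibility lemma. -/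
lemma TG.vis_step {S adj} (T : TG S adj) (s : ℝ) (hs : s = 1 ∨ s = -1) (p w u v y y2 z : Pt)
    (hp : p ∈ S) (hw : w ∈ S) (huv : adj u v)
    (hAu : 0 < s * ori p w u) (hAv : s * ori p w v < 0)
    (hBp : 0 < s * ori v u p) (hBw : s * ori v u w < 0)
    (hAy : 0 < s * ori p w y) (hCy : 0 ≤ s * ori u p y) (hBy : 0 ≤ s * ori v u y)
    (hmin : ∀ q ∈ S, 0 < s * ori p w q → 0 ≤ s * ori u p q → 0 ≤ s * ori v u q →
      s * ori p q y ≤ 0)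
    (hyz : adj y2 z) (hcr : Cr p y y2 z) (hz : s * ori p y z < 0) :
    Cr p w y2 z := by
  have hss : s * s = 1 := by rcases hs with rfl | rfl <;> norm_num
  obtain ⟨l, t, hl0, hl1, ht0, ht1, hx⟩ := hcr.pt
  obtain ⟨c, hc1⟩ : ∃ c, c = (1 - l) • p + l • y := ⟨_, rfl⟩
  have hc2 : c = (1 - t) • y2 + t • z := by rw [hc1, hx]
  have hpw : p ≠ w := by rintro rfl; rw [ori_self3] at hAu; simp at hAu
  have hYc : ori y2 z c = 0 := by rw [hc2, ori_comb, ori_self1, ori_self2]; ring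
  have hDc : ori p y c = 0 := by rw [hc1, ori_comb, ori_self1, ori_self2]; ring
  have hAc : 0 < s * ori p w c := by
    rw [hc1, ori_comb, ori_self1]
    have := mul_pos hl0 hAy
    linarith
  have hBc : 0 < s * ori v u c := by
    rw [hc1, ori_comb]
    have := mul_nonneg hl0.le hBy
    have := mul_pos (sub_pos.2 hl1) hBp
    linarith
  have hA2 : s * ori p w c = (1 - t) * (s * ori p w y2) + t * (s * ori p w z) := by
    rw [hc2, ori_comb]; ring
  have hB2 : s * ori v u c = (1 - t) * (s * ori v u y2) + t * (s * ori v u z) := by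
    rw [hc2, ori_comb]; ring
  have hD : ∀ q, (s * ori p y q) * (s * ori p w u) =
      (s * ori u p y) * (s * ori p w q) - (s * ori p w y) * (s * ori u p q) := by
    intro q
    have := ori_pl p w u y q
    rw [ori_rot u p y, ori_rot u p q]
    linear_combination (s * s) * this
  have hDz := hD z
  have hDc' := hD c
  rw [hDc] at hDc'
  have case1 : s * ori v u z < 0 →
      0 ≤ -(s * ori v u z) * (s * ori p w c) + (s * ori v u c) * (s * ori p w z) → False := by
    intro hBz hK
    have hCr : 0 < -(s * ori v u z) * (s * ori u p c) + (s * ori v u c) * (s * ori u p z) := by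
      have e : (s * ori p w y) *
          (-(s * ori v u z) * (s * ori u p c) + (s * ori v u c) * (s * ori u p z)) =
          (s * ori u p y) *
            (-(s * ori v u z) * (s * ori p w c) + (s * ori v u c) * (s * ori p w z))
          - (s * ori v u c) * ((s * ori p y z) * (s * ori p w u)) := by
        linear_combination -(s * ori v u z) * hDc' + (s * ori v u c) * hDz
      have h1 := mul_nonneg hCy hK
      have h2 := mul_pos hBc (mul_pos (neg_pos.2 hz) hAu)
      by_contra hcon
      push Not at hcon
      have := mul_nonpos_of_nonneg_of_nonpos hAy.le hcon
      nlinarith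
    have hvq : ∀ q, (s * ori p v q) * (s * ori p w u) =
        (s * ori v u p) * (s * ori p w q) - (s * ori p w v) * (s * ori u p q) := by
      intro q
      have := ori_pl p w u v q
      rw [ori_rot u p q, ← ori_rot p v u]
      linear_combination (s * s) * this
    have hV : 0 < -(s * ori v u z) * (s * ori p v c) + (s * ori v u c) * (s * ori p v z) := by
      have e : (-(s * ori v u z) * (s * ori p v c) + (s * ori v u c) * (s * ori p v z)) *
          (s * ori p w u) = (s * ori v u p) *
            (-(s * ori v u z) * (s * ori p w c) + (s * ori v u c) * (s * ori p w z))
          - (s * ori p w v) *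
            (-(s * ori v u z) * (s * ori u p c) + (s * ori v u c) * (s * ori u p z)) := by
        linear_combination -(s * ori v u z) * hvq c + (s * ori v u c) * hvq z
      have h1 := mul_nonneg hBp.le hK
      have h2 := mul_pos (neg_pos.2 hAv) hCr
      by_contra hcon
      push Not at hcon
      have := mul_nonpos_of_nonpos_of_nonneg hcon hAu.le
      nlinarith
    have hBy2 : 0 < s * ori v u y2 := by
      by_contra hcon
      push Not at hcon
      nlinarith
    refine T.nc (T.symm huv) hyz ⟨?_, ?_⟩
    · have : (s * ori v u y2) * (s * ori v u z) < 0 := mul_neg_of_pos_of_neg hBy2 hBz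
      have e : (s * ori v u y2) * (s * ori v u z) = ori v u y2 * ori v u z := by
        linear_combination (ori v u y2 * ori v u z) * hss
      rwa [e] at this
    · have b1 := ori_bary v u p y2 z c
      have b2 := ori_bary v u p y2 z z
      rw [hYc] at b1
      rw [ori_self2] at b2
      refine opp_of_comb hCr hV ?_ ?_
      · linear_combination (s^2 * ori v u z) * b1 - (s^2 * ori v u c) * b2
      · refine T.gp _ (T.mem hyz) _ (T.mem' hyz) _ (T.mem' huv) (T.ne hyz) ?_ ?_
        · rintro rfl; rw [ori_self1] at hBy2; simp at hBy2
        · rintro rfl; rw [ori_self1] at hBz; simp at hBz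
  have hAz : s * ori p w z < 0 := by
    by_contra hAz
    push Not at hAz
    have hBz : 0 ≤ s * ori v u z := by
      by_contra hBz
      push Not at hBz
      exact case1 hBz (by
        have := mul_pos (neg_pos.2 hBz) hAc
        have := mul_nonneg hBc.le hAz
        linarith)
    have hzp : p ≠ z := by rintro rfl; rw [ori_self1] at hz; simp at hz
    have hzw : w ≠ z := by rintro rfl; linarith
    have hne := T.gp _ hp _ hw _ (T.mem' hyz) hpw hzp hzw
    have hAz' : 0 < s * ori p w z := by
      refine lt_of_le_of_ne hAz (Ne.symm ?_)
      have : s ≠ 0 := by rintro rfl; simp at hss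
      exact mul_ne_zero this hne
    have hCz : 0 ≤ s * ori u p z := by
      by_contra hCz
      push Not at hCz
      nlinarith [mul_nonneg hCy hAz, mul_pos hAy (neg_pos.2 hCz), mul_pos (neg_pos.2 hz) hAu]
    have := hmin z (T.mem' hyz) hAz' hCz hBz
    rw [ori_swap' p z y] at this
    linarith
  have hBr : 0 < -(s * ori p w z) * (s * ori v u c) + (s * ori p w c) * (s * ori v u z) := by
    by_contra hcon
    push Not at hcon
    have hBz : s * ori v u z < 0 := by
      by_contra hBz
      push Not at hBz
      nlinarith [mul_pos (neg_pos.2 hAz) hBc, mul_nonneg hAc.le hBz]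
    exact case1 hBz (by linarith)
  have hAy2 : 0 < s * ori p w y2 := by
    by_contra hcon
    push Not at hcon
    nlinarith
  refine ⟨?_, ?_⟩
  · have : (s * ori p w y2) * (s * ori p w z) < 0 := mul_neg_of_pos_of_neg hAy2 hAz
    have e : (s * ori p w y2) * (s * ori p w z) = ori p w y2 * ori p w z := by
      linear_combination (ori p w y2 * ori p w z) * hss
    rwa [e] at this
  · have hCr : 0 < -(s * ori p w z) * (s * ori u p c) + (s * ori p w c) * (s * ori u p z) := by
      have e : (s * ori p w y) *
          (-(s * ori p w z) * (s * ori u p c) + (s * ori p w c) * (s * ori u p z)) =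
          - (s * ori p w c) * ((s * ori p y z) * (s * ori p w u)) := by
        linear_combination -(s * ori p w z) * hDc' + (s * ori p w c) * hDz
      have h2 := mul_pos hAc (mul_pos (neg_pos.2 hz) hAu)
      by_contra hcon
      push Not at hcon
      have := mul_nonpos_of_nonneg_of_nonpos hAy.le hcon
      nlinarith
    have hW : 0 < -(s * ori p w z) * (s * ori w u c) + (s * ori p w c) * (s * ori w u z) := by
      have c1 := ori_bary p w u v u c
      have c2 := ori_bary p w u v u z
      rw [ori_self2] at c1 c2
      have e : (-(s * ori p w z) * (s * ori w u c) + (s * ori p w c) * (s * ori w u z)) *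
          (s * ori v u p) = (s * ori p w u) *
          (-(s * ori p w z) * (s * ori v u c) + (s * ori p w c) * (s * ori v u z)) -
          (s * ori v u w) *
          (-(s * ori p w z) * (s * ori u p c) + (s * ori p w c) * (s * ori u p z)) := by
        linear_combination (s^3 * ori p w z) * c1 - (s^3 * ori p w c) * c2
      have h1 := mul_pos hAu hBr
      have h2 := mul_pos (neg_pos.2 hBw) hCr
      by_contra hcon
      push Not at hcon
      have := mul_nonpos_of_nonpos_of_nonneg hcon hBp.le
      nlinarith
    have b1 := ori_bary p w u y2 z c
    have b2 := ori_bary p w u y2 z z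
    rw [hYc] at b1
    rw [ori_self2] at b2
    refine opp_of_comb hW hCr ?_ ?_
    · linear_combination (s^2 * ori p w z) * b1 - (s^2 * ori p w c) * b2
    · have := hcr.2
      intro h0
      rw [h0] at this
      simp at this
lemma TG.vis {S adj} (T : TG S adj) (f1 f2 : ℝ) (p q : Pt) (hp : p ∈ S) (hq : q ∈ S)
    (hpq : f1 * p.1 + f2 * p.2 < f1 * q.1 + f2 * q.2) :
    ∃ u, adj p u ∧ f1 * p.1 + f2 * p.2 < f1 * u.1 + f2 * u.2 := by
  obtain ⟨w, hw, hwmin⟩ := (S.filter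
    (fun w => f1 * p.1 + f2 * p.2 < f1 * w.1 + f2 * w.2)).exists_min_image
    (fun w => ((S ×ˢ S).filter (fun e => adj e.1 e.2 ∧ Cr p w e.1 e.2)).card)
    ⟨q, by simp only [Finset.mem_filter]; exact ⟨hq, hpq⟩⟩
  simp only [Finset.mem_filter] at hw hwmin
  obtain ⟨hwS, hfw⟩ := hw
  have hpw : p ≠ w := by rintro rfl; exact lt_irrefl _ hfw
  by_cases hbl : ∀ c d, adj c d → ¬ Cr p w c d
  · exact ⟨w, T.mx p hp w hwS hpw hbl, hfw⟩
  exfalso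
  push Not at hbl
  have huv : ∃ u v, adj u v ∧ Cr p w u v ∧ f1 * p.1 + f2 * p.2 < f1 * u.1 + f2 * u.2 := by
    obtain ⟨u, v, huv, hcr⟩ := hbl
    obtain ⟨l, t, hl0, hl1, ht0, ht1, hx⟩ := hcr.pt
    have x1 := congrArg Prod.fst hx
    have x2 := congrArg Prod.snd hx
    simp only [Prod.fst_add, Prod.snd_add, Prod.smul_fst, Prod.smul_snd, smul_eq_mul] at x1 x2
    by_cases hu : f1 * p.1 + f2 * p.2 < f1 * u.1 + f2 * u.2
    · exact ⟨u, v, huv, hcr, hu⟩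
    · refine ⟨v, u, T.symm huv, hcr.swap_right, ?_⟩
      by_contra hv
      push Not at hu hv
      have e : l * ((f1 * w.1 + f2 * w.2) - (f1 * p.1 + f2 * p.2)) =
        (1 - t) * ((f1 * u.1 + f2 * u.2) - (f1 * p.1 + f2 * p.2)) +
        t * ((f1 * v.1 + f2 * v.2) - (f1 * p.1 + f2 * p.2)) := by
        linear_combination f1 * x1 + f2 * x2
      have h1 := mul_pos hl0 (sub_pos.2 hfw)
      have h2 := mul_nonneg (sub_pos.2 ht1).le (sub_nonneg.2 hu)
      have h3 := mul_nonneg ht0.le (sub_nonneg.2 hv)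
      linarith
  obtain ⟨u, v, huv, hcr, hfu⟩ := huv
  obtain ⟨s, hs, hAu⟩ : ∃ s : ℝ, (s = 1 ∨ s = -1) ∧ 0 < s * ori p w u := by
    have : ori p w u ≠ 0 := by intro h; have := hcr.1; rw [h] at this; simp at this
    rcases lt_or_gt_of_ne this with h | h
    · exact ⟨-1, Or.inr rfl, by linarith⟩
    · exact ⟨1, Or.inl rfl, by linarith⟩
  have hss : s * s = 1 := by rcases hs with rfl | rfl <;> norm_num
  have hAv : s * ori p w v < 0 := by
    have h1 : (s * ori p w u) * (s * ori p w v) < 0 := by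
      have e : (s * ori p w u) * (s * ori p w v) = ori p w u * ori p w v := by
        linear_combination (ori p w u * ori p w v) * hss
      rw [e]; exact hcr.1
    by_contra hc
    push Not at hc
    linarith [mul_nonneg hAu.le hc]
  have hB : s * ori v u p - s * ori v u w = s * ori p w u - s * ori p w v := by
    unfold ori; ring
  have hB2 : (s * ori v u p) * (s * ori v u w) < 0 := by
    have e : (s * ori v u p) * (s * ori v u w) = ori u v p * ori u v w := by
      rw [ori_swap v u p, ori_swap v u w]
      linear_combination (ori u v p * ori u v w) * hss
    rw [e]; exact hcr.2
  obtain ⟨hBp, hBw⟩ : 0 < s * ori v u p ∧ s * ori v u w < 0 := by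
    rcases mul_neg_iff.1 hB2 with h | h
    · exact h
    · linarith [h.1, h.2]
  obtain ⟨y, hy, hymin⟩ := exists_first s p w
    (S.filter (fun y => 0 < s * ori p w y ∧ 0 ≤ s * ori u p y ∧ 0 ≤ s * ori v u y))
    ⟨u, by
      simp only [Finset.mem_filter]
      refine ⟨T.mem huv, hAu, ?_, ?_⟩
      · rw [ori_self1]; simp
      · rw [ori_self2]; simp⟩
    (by intro x hx; simp only [Finset.mem_filter] at hx; exact hx.2.1)
  simp only [Finset.mem_filter] at hy hymin
  obtain ⟨hyS, hAy, hCy, hBy⟩ := hy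
  have hmin : ∀ q ∈ S, 0 < s * ori p w q → 0 ≤ s * ori u p q → 0 ≤ s * ori v u q →
      s * ori p q y ≤ 0 := fun q h1 h2 h3 h4 => hymin q ⟨h1, h2, h3, h4⟩
  have hfy : f1 * p.1 + f2 * p.2 < f1 * y.1 + f2 * y.2 := by
    have e : (s * ori p w u) * ((f1 * y.1 + f2 * y.2) - (f1 * p.1 + f2 * p.2)) =
      (s * ori u p y) * ((f1 * w.1 + f2 * w.2) - (f1 * p.1 + f2 * p.2)) +
      (s * ori p w y) * ((f1 * u.1 + f2 * u.2) - (f1 * p.1 + f2 * p.2)) := by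
      unfold ori; ring
    have h1 := mul_nonneg hCy (sub_pos.2 hfw).le
    have h2 := mul_pos hAy (sub_pos.2 hfu)
    by_contra hc
    push Not at hc
    have := mul_nonneg hAu.le (sub_nonneg.2 hc)
    linarith
  refine absurd (hwmin y ⟨hyS, hfy⟩) (not_le.2 (Finset.card_lt_card ?_))
  refine (Finset.ssubset_iff_of_subset ?_).2 ⟨(u, v), ?_, ?_⟩
  · rintro ⟨e1, e2⟩ he
    simp only [Finset.mem_filter] at he ⊢
    obtain ⟨heS, hadj, hc⟩ := he
    refine ⟨heS, hadj, ?_⟩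
    have hc1 : (s * ori p y e1) * (s * ori p y e2) < 0 := by
      have e : (s * ori p y e1) * (s * ori p y e2) = ori p y e1 * ori p y e2 := by
        linear_combination (ori p y e1 * ori p y e2) * hss
      rw [e]; exact hc.1
    rcases mul_neg_iff.1 hc1 with h | h
    · exact T.vis_step s hs p w u v y e1 e2 hp hwS huv hAu hAv hBp hBw hAy hCy hBy hmin
        hadj hc h.2
    · exact (T.vis_step s hs p w u v y e2 e1 hp hwS huv hAu hAv hBp hBw hAy hCy hBy hmin
        (T.symm hadj) hc.swap_right h.1).swap_right
  · simp only [Finset.mem_filter, Finset.mem_product]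
    exact ⟨⟨T.mem huv, T.mem' huv⟩, huv, hcr⟩
  · simp only [Finset.mem_filter, not_and]
    rintro _ _ hc
    have e : (s * ori v u p) * (s * ori v u y) = ori u v p * ori u v y := by
      rw [ori_swap v u p, ori_swap v u y]
      linear_combination (ori u v p * ori u v y) * hss
    have := hc.2
    rw [← e] at this
    linarith [mul_nonneg hBp.le hBy]

lemma TG.face {S adj} (T : TG S adj) (a b q : Pt) (hab : adj a b) (hq : q ∈ S)
    (h : 0 < ori a b q) : ∃ c, Fc S adj a b c := by
  obtain ⟨u, hau, hu⟩ := T.vis (-(b.2 - a.2)) (b.1 - a.1) a q (T.mem hab) hq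
    (by unfold ori at h; linarith)
  have hu' : 0 < ori a b u := by unfold ori; linarith
  obtain ⟨c, hc, hmin⟩ := exists_first 1 a b (S.filter (fun x => adj a x ∧ 0 < ori a b x))
    ⟨u, by simp only [Finset.mem_filter]; exact ⟨T.mem' hau, hau, hu'⟩⟩
    (by intro x hx; simp only [Finset.mem_filter] at hx; rw [one_mul]; exact hx.2.2)
  simp only [Finset.mem_filter] at hc hmin
  refine ⟨c, T.face_of_next a b c hab hc.2.1 hc.2.2 ?_⟩
  intro d had h1 h2
  have := hmin d ⟨T.mem' had, had, h1⟩
  rw [← ori_rot c a d] at this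
  linarith

lemma Fc.rot {S adj a b c} (h : Fc S adj a b c) : Fc S adj b c a := by
  obtain ⟨h1, h2, h3, h4, h5⟩ := h
  refine ⟨by rwa [← ori_rot a b c], h3, h4, h2, ?_⟩
  rintro p hp ⟨k1, k2, k3⟩
  exact h5 p hp ⟨k3, k1, k2⟩

lemma Fc.ne {S adj a b c} (h : Fc S adj a b c) (T : TG S adj) : a ≠ b ∧ b ≠ c ∧ c ≠ a :=
  ⟨T.ne h.2.1, T.ne h.2.2.1, T.ne h.2.2.2.1⟩

lemma TG.uniq {S adj} (T : TG S adj) {a b c c' : Pt} (h : Fc S adj a b c) (h' : Fc S adj a b c') :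
    c = c' := by
  by_contra hne
  have hn := h.ne T
  have hn' := h'.ne T
  have haS := T.mem h.2.1
  have hbS := T.mem' h.2.1
  have hcS := T.mem h.2.2.2.1
  have hcS' := T.mem h'.2.2.2.1
  have key : ∀ c c', Fc S adj a b c → Fc S adj a b c' → c ≠ c' → 0 < ori a c c' → False := by
    intro c c' h h' hne h1
    have hn := h.ne T
    have hn' := h'.ne T
    have hcS := T.mem h.2.2.2.1
    have hcS' := T.mem h'.2.2.2.1
    rcases lt_or_gt_of_ne (T.gp b hbS c hcS c' hcS' hn.2.1 hn'.2.1 hne) with k | k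
    · refine h'.2.2.2.2 c hcS ⟨h.1, ?_, ?_⟩
      · rw [ori_swap' b c' c]; linarith
      · rw [ori_rot]; exact h1
    · refine T.nc (T.symm h.2.2.2.1) h'.2.2.1 ⟨?_, ?_⟩
      · refine mul_neg_of_neg_of_pos ?_ h1
        rw [ori_swap']; linarith [h.1]
      · refine mul_neg_of_pos_of_neg ?_ ?_
        · rw [← ori_rot a b c']; exact h'.1
        · rw [ori_swap']; linarith
  rcases lt_or_gt_of_ne (T.gp a haS c hcS c' hcS' hn.2.2.symm hn'.2.2.symm hne) with k | k
  · exact key c' c h' h (Ne.symm hne) (by rw [ori_swap']; linarith)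
  · exact key c c' h h' hne k

lemma TG.cone_empty {S adj} (T : TG S adj) {a b c e : Pt} (h : Fc S adj a b c) (he : adj a e)
    (h1 : 0 < ori a b e) (h2 : 0 < ori a e c) : False := by
  have hn := h.ne T
  have heb : b ≠ e := by rintro rfl; rw [ori_self2] at h1; simp at h1
  have hec : c ≠ e := by rintro rfl; rw [ori_self2] at h2; simp at h2
  rcases lt_or_gt_of_ne (T.gp b (T.mem' h.2.1) c (T.mem h.2.2.2.1) e (T.mem' he)
    hn.2.1 heb hec) with k | k
  · refine T.nc h.2.2.1 he ⟨?_, ?_⟩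
    · refine mul_neg_of_pos_of_neg ?_ k
      rw [← ori_rot a b c]; exact h.1
    · refine mul_neg_of_neg_of_pos ?_ h2
      rw [ori_swap']; linarith
  · exact h.2.2.2.2 e (T.mem' he) ⟨h1, k, by rw [ori_rot]; exact h2⟩

/-- The edge `ab` is reflex at `a`. -/
def Rt (S : Finset Pt) (adj : Pt → Pt → Prop) (a b c d : Pt) : Prop :=
  Fc S adj a b c ∧ Fc S adj a d b ∧ 0 < ori a c d

lemma TG.rt_other {S adj} (T : TG S adj) {a b c d e : Pt} (h : Rt S adj a b c d) (he : adj a e)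
    (hb : e ≠ b) (hc : e ≠ c) (hd : e ≠ d) : 0 < ori a c e ∧ 0 < ori a e d := by
  obtain ⟨f1, f2, h3⟩ := h
  have haS := T.mem he
  have heS := T.mem' he
  have hae := T.ne he
  have x0 := T.gp a haS e heS b (T.mem' f1.2.1) hae (T.ne f1.2.1) hb
  have y0 := T.gp a haS e heS c (T.mem f1.2.2.2.1) hae (T.ne f1.2.2.2.1).symm hc
  have z0 := T.gp a haS e heS d (T.mem' f2.2.1) hae (T.ne f2.2.1) hd
  have n1 : ¬ (ori a e b < 0 ∧ 0 < ori a e c) := fun hh =>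
    T.cone_empty f1 he (by rw [ori_swap']; linarith [hh.1]) hh.2
  have n2 : ¬ (ori a e d < 0 ∧ 0 < ori a e b) := fun hh =>
    T.cone_empty f2 he (by rw [ori_swap']; linarith [hh.1]) hh.2
  have id : ori a c d * ori a e b + ori a d b * ori a e c + ori a b c * ori a e d = 0 := by
    unfold ori; ring
  have P := f1.1
  have Q := f2.1
  rw [ori_swap' a c e]
  rcases lt_or_gt_of_ne x0 with x | x
  · have y : ori a e c < 0 := by
      rcases lt_or_gt_of_ne y0 with y | y
      · exact y
      · exact absurd ⟨x, y⟩ n1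
    refine ⟨by linarith, ?_⟩
    by_contra hc
    push Not at hc
    nlinarith [mul_pos h3 (neg_pos.2 x), mul_pos Q (neg_pos.2 y),
      mul_nonneg P.le (neg_nonneg.2 hc)]
  · have z : 0 < ori a e d := by
      rcases lt_or_gt_of_ne z0 with z | z
      · exact absurd ⟨z, x⟩ n2
      · exact z
    refine ⟨?_, z⟩
    by_contra hc
    push Not at hc
    nlinarith [mul_pos h3 x, mul_pos P z, mul_nonneg Q.le (by linarith : 0 ≤ ori a e c)]

lemma TG.rt_two {S adj} (T : TG S adj) {a b c d b' c' d' : Pt} (h : Rt S adj a b c d)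
    (h' : Rt S adj a b' c' d') (hne : b ≠ b') : b' = c ∨ b' = d := by
  by_contra hcon
  push Not at hcon
  obtain ⟨hc, hd⟩ := hcon
  have ab := h.1.2.1
  have ac := T.symm h.1.2.2.2.1
  have ad := h.2.1.2.1
  have ab' := h'.1.2.1
  have ac' := T.symm h'.1.2.2.2.1
  have ad' := h'.2.1.2.1
  obtain ⟨k1, k2⟩ := T.rt_other h ab' hne.symm hc hd
  by_cases e1 : b = c'
  · subst e1
    exact T.cone_empty h'.1 ad k2 h.2.1.1
  by_cases e2 : b = d'
  · subst e2
    exact T.cone_empty h'.2.1 ac h.1.1 k1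
  obtain ⟨m1, m2⟩ := T.rt_other h' ab hne e1 e2
  have p1 := h'.1.1
  have p2 := h'.2.1.1
  have p3 := h'.2.2
  have sw : ∀ x y, ori a x y = - ori a y x := fun x y => ori_swap' a x y
  have c1 : c' ≠ c := by rintro rfl; linarith [sw b' c']
  have d1 : d' ≠ d := by rintro rfl; linarith [sw b' d']
  have q1 : 0 < ori a c c' := by
    by_cases e : c' = d
    · subst e; exact h.2.2
    · exact (T.rt_other h ac' (Ne.symm e1) c1 e).1
  have q2 : 0 < ori a c d' := by
    by_cases e : d' = c
    · subst e; linarith [sw d' c']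
    · exact (T.rt_other h ad' (Ne.symm e2) e d1).1
  have id : ori a c b' * ori a d' c' = ori a c d' * ori a b' c' + ori a c c' * ori a d' b' := by
    unfold ori; ring
  have := sw d' c'
  nlinarith [mul_pos q2 p1, mul_pos q1 p2, mul_pos k1 p3]

lemma TG.rt_three {S adj} (T : TG S adj) {a b1 c1 d1 b2 c2 d2 b3 c3 d3 e : Pt}
    (h1 : Rt S adj a b1 c1 d1) (h2 : Rt S adj a b2 c2 d2) (h3 : Rt S adj a b3 c3 d3)
    (n12 : b1 ≠ b2) (n13 : b1 ≠ b3) (n23 : b2 ≠ b3) (he : adj a e) :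
    e = b1 ∨ e = b2 ∨ e = b3 := by
  by_contra hcon
  push Not at hcon
  obtain ⟨e1, e2, e3⟩ := hcon
  have sw : ∀ x y, ori a x y = - ori a y x := fun x y => ori_swap' a x y
  have q1 := h1.1.1
  have q2 := h1.2.1.1
  have q3 := h2.1.1
  have q4 := h2.2.1.1
  have a1 := T.rt_two h1 h2 n12
  have a2 := T.rt_two h1 h3 n13
  have a3 := T.rt_two h2 h3 n23
  have a4 := T.rt_two h2 h1 n12.symm
  have r1 := T.rt_other h1 he e1
  have r2 := T.rt_other h2 he e2
  rcases a1 with a1 | a1 <;> rcases a2 with a2 | a2 <;> rcases a3 with a3 | a3 <;>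
    rcases a4 with a4 | a4 <;>
    first
    | exact n23 (a1.trans a2.symm)
    | exact n13 (a4.trans a3.symm)
    | (subst a1 a2
       rw [← a3, ← a4] at r2
       simp only [← a3, ← a4] at q3 q4
       obtain ⟨r1, r1'⟩ := r1 (by assumption) (by assumption)
       obtain ⟨r2, r2'⟩ := r2 (by assumption) (by assumption)
       linarith [sw b1 b2, sw b1 b3, sw b2 b3, sw b1 e, sw b2 e, sw b3 e])
lemma notin_int (f1 f2 : ℝ) (X : Set Pt) (p : Pt) (hf : f1 ≠ 0 ∨ f2 ≠ 0)
    (h : ∀ x ∈ X, f1 * x.1 + f2 * x.2 ≤ f1 * p.1 + f2 * p.2) : p ∉ interior (convexHull ℝ X) := by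
  intro hp
  have hconv : Convex ℝ {x : Pt | f1 * x.1 + f2 * x.2 ≤ f1 * p.1 + f2 * p.2} := by
    intro x hx y hy a b ha hb hab
    simp only [Set.mem_ofPred_eq, Prod.fst_add, Prod.snd_add, Prod.smul_fst, Prod.smul_snd,
      smul_eq_mul] at *
    have h1 := mul_le_mul_of_nonneg_left hx ha
    have h2 := mul_le_mul_of_nonneg_left hy hb
    have h3 : (a + b) * (f1 * p.1 + f2 * p.2) = f1 * p.1 + f2 * p.2 := by rw [hab, one_mul]
    linarith
  have hsub : convexHull ℝ X ⊆ {x : Pt | f1 * x.1 + f2 * x.2 ≤ f1 * p.1 + f2 * p.2} :=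
    convexHull_min (fun x hx => h x hx) hconv
  have hc : Continuous (fun t : ℝ => ((p.1 + t * f1, p.2 + t * f2) : Pt)) := by fun_prop
  have hn : (fun t : ℝ => ((p.1 + t * f1, p.2 + t * f2) : Pt)) ⁻¹' (interior (convexHull ℝ X)) ∈
      nhds (0 : ℝ) := (isOpen_interior.preimage hc).mem_nhds (by simpa using hp)
  obtain ⟨ε, hε, hb⟩ := Metric.mem_nhds_iff.1 hn
  have h1 : (ε / 2) ∈ Metric.ball (0 : ℝ) ε := by
    simp only [Metric.mem_ball, Real.dist_eq, sub_zero]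
    rw [abs_of_pos (by linarith)]; linarith
  have h2 := hsub (interior_subset (hb h1))
  simp only [Set.mem_ofPred_eq] at h2
  have h3 : 0 < f1 ^ 2 + f2 ^ 2 := by
    rcases hf with hf | hf
    · have := sq_pos_of_ne_zero hf; nlinarith [sq_nonneg f2]
    · have := sq_pos_of_ne_zero hf; nlinarith [sq_nonneg f1]
  nlinarith [mul_pos hε h3]

lemma front_of_max (f1 f2 : ℝ) (S : Finset Pt) (p : Pt) (hp : p ∈ S) (hf : f1 ≠ 0 ∨ f2 ≠ 0)
    (h : ∀ x ∈ S, f1 * x.1 + f2 * x.2 ≤ f1 * p.1 + f2 * p.2) :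
    p ∈ frontier (convexHull ℝ (S : Set Pt)) :=
  ⟨subset_closure (subset_convexHull ℝ _ (by exact_mod_cast hp)),
    notin_int f1 f2 _ p hf (fun x hx => h x (by exact_mod_cast hx))⟩

lemma not_front (S : Finset Pt) (p a b c : Pt) (ha : a ∈ S) (hb : b ∈ S) (hc : c ∈ S)
    (h1 : 0 < ori a b p) (h2 : 0 < ori b c p) (h3 : 0 < ori c a p) :
    p ∉ frontier (convexHull ℝ (S : Set Pt)) := by
  have hin : p ∈ interior (convexHull ℝ (S : Set Pt)) := by
    rw [mem_interior]
    refine ⟨{x | 0 < ori a b x ∧ 0 < ori b c x ∧ 0 < ori c a x}, ?_, ?_, ⟨h1, h2, h3⟩⟩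
    · rintro x ⟨k1, k2, k3⟩
      have hD := ori_sum a b c x
      have hD0 : 0 < ori a b c := by linarith
      have hx : x = (ori b c x / ori a b c) • a + (ori c a x / ori a b c) • b
          + (ori a b x / ori a b c) • c := by
        have hne := hD0.ne'
        ext
        · simp only [Prod.fst_add, Prod.smul_fst, smul_eq_mul]
          field_simp
          unfold ori; ring
        · simp only [Prod.snd_add, Prod.smul_snd, smul_eq_mul]
          field_simp
          unfold ori; ring
      have hconv := convex_convexHull ℝ (S : Set Pt)
      rw [hx]
      have := hconv.sum_mem (t := Finset.univ) (w := ![ori b c x / ori a b c, ori c a x / ori a b c,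
        ori a b x / ori a b c]) (z := ![a, b, c]) ?_ ?_ ?_
      · simpa [Fin.sum_univ_three] using this
      · intro i _
        fin_cases i <;> simp <;> positivity
      · simp [Fin.sum_univ_three]
        field_simp
        linarith
      · intro i _
        fin_cases i <;> exact subset_convexHull ℝ _ (by simpa)
    · have c1 : ∀ u v : Pt, Continuous (fun x : Pt => ori u v x) := by
        intro u v; unfold ori; fun_prop
      exact (isOpen_lt continuous_const (c1 a b)).inter ((isOpen_lt continuous_const (c1 b c)).inter
        (isOpen_lt continuous_const (c1 c a)))
  exact fun h => h.2 hin

/-- a point on no hull boundary has points on the left of each dart -/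
lemma left_of_int (S : Finset Pt) (p r : Pt) (hp : p ∈ S) (hpr : p ≠ r)
    (hi : p ∉ frontier (convexHull ℝ (S : Set Pt))) : ∃ q ∈ S, 0 < ori p r q := by
  by_contra hcon
  push Not at hcon
  apply hi
  apply front_of_max (-(r.2 - p.2)) (r.1 - p.1) S p hp
  · by_contra h
    push Not at h
    apply hpr
    ext <;> linarith [h.1, h.2]
  · intro x hx
    have := hcon x hx
    unfold ori at this; linarith

lemma right_of_int (S : Finset Pt) (p r : Pt) (hp : p ∈ S) (hpr : p ≠ r)
    (hi : p ∉ frontier (convexHull ℝ (S : Set Pt))) : ∃ q ∈ S, 0 < ori r p q := by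
  by_contra hcon
  push Not at hcon
  apply hi
  apply front_of_max ((r.2 - p.2)) (-(r.1 - p.1)) S p hp
  · by_contra h
    push Not at h
    apply hpr
    ext <;> linarith [h.1, h.2]
  · intro x hx
    have := hcon x hx
    unfold ori at this; linarith

/-- adjacency in a plane graph -/
def PAdj {S : Finset Pt} (T : PlaneGraph S) (a b : Pt) : Prop := s(a, b) ∈ T.edges

lemma collinear_of_ori {a b c : Pt} (hab : a ≠ b) (h : ori a b c = 0) :
    Collinear ℝ ({a, b, c} : Set Pt) := by
  rw [collinear_iff_of_mem (p₀ := a) (by simp)]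
  refine ⟨b - a, ?_⟩
  have hn : 0 < (b.1 - a.1)^2 + (b.2 - a.2)^2 := by
    by_contra hcon
    have h1 : b.1 - a.1 = 0 := by nlinarith [sq_nonneg (b.1 - a.1), sq_nonneg (b.2 - a.2)]
    have h2 : b.2 - a.2 = 0 := by nlinarith [sq_nonneg (b.1 - a.1), sq_nonneg (b.2 - a.2)]
    apply hab; ext <;> linarith
  intro p hp
  simp only [Set.mem_insert_iff, Set.mem_singleton_iff] at hp
  rcases hp with rfl | rfl | rfl
  · exact ⟨0, by simp⟩
  · exact ⟨1, by simp⟩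
  · refine ⟨((p.1 - a.1) * (b.1 - a.1) + (p.2 - a.2) * (b.2 - a.2)) /
      ((b.1 - a.1)^2 + (b.2 - a.2)^2), ?_⟩
    unfold ori at h
    ext
    · simp only [vadd_eq_add, Prod.fst_add, Prod.smul_fst, Prod.fst_sub, smul_eq_mul]
      field_simp
      linear_combination -(b.2 - a.2) * h
    · simp only [vadd_eq_add, Prod.snd_add, Prod.smul_snd, Prod.snd_sub, smul_eq_mul]
      field_simp
      linear_combination (b.1 - a.1) * h

lemma mem_seg {a b x : Pt} (h : x ∈ segment ℝ a b) : ∃ t : ℝ, 0 ≤ t ∧ t ≤ 1 ∧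
    x = (1 - t) • a + t • b := by
  obtain ⟨u, v, hu, hv, huv, rfl⟩ := h
  exact ⟨v, hv, by linarith, by rw [← huv]; simp⟩

lemma seg_mem {a b : Pt} {t : ℝ} (h0 : 0 ≤ t) (h1 : t ≤ 1) :
    (1 - t) • a + t • b ∈ segment ℝ a b := ⟨1 - t, t, by linarith, h0, by ring, rfl⟩

/-- Segments with a common endpoint, not collinear, meet only there -/
lemma shared_end {a b c x : Pt} (h : ori a b c ≠ 0) (h1 : x ∈ segment ℝ a b)
    (h2 : x ∈ segment ℝ a c) : x = a := by
  obtain ⟨t, t0, t1, rfl⟩ := mem_seg h1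
  obtain ⟨u, u0, u1, hu⟩ := mem_seg h2
  have e := congrArg (fun y => ori a b y) hu
  simp only [ori_comb, ori_self1, ori_self2, mul_zero, zero_add, add_zero] at e
  have : u = 0 := by
    rcases mul_eq_zero.1 e.symm with h' | h'
    · exact h'
    · exact absurd h' h
  rw [hu, this]; simp

lemma cr_of_meet {a b c d x : Pt} (h1 : ori a b c ≠ 0) (h2 : ori a b d ≠ 0) (h3 : ori c d a ≠ 0)
    (h4 : ori c d b ≠ 0) (hx1 : x ∈ segment ℝ a b) (hx2 : x ∈ segment ℝ c d) : Cr a b c d := by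
  obtain ⟨t, t0, t1, ht⟩ := mem_seg hx1
  obtain ⟨u, u0, u1, hu⟩ := mem_seg hx2
  have e1 : (1 - u) * ori a b c + u * ori a b d = 0 := by
    rw [← ori_comb, ← hu, ht, ori_comb, ori_self1, ori_self2]; ring
  have e2 : (1 - t) * ori c d a + t * ori c d b = 0 := by
    rw [← ori_comb, ← ht, hu, ori_comb, ori_self1, ori_self2]; ring
  have aux : ∀ v P Q : ℝ, 0 ≤ v → v ≤ 1 → P ≠ 0 → Q ≠ 0 → (1 - v) * P + v * Q = 0 →
      P * Q < 0 := by
    intro v P Q v0 v1 hP hQ e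
    have n0 : v ≠ 0 := by rintro rfl; apply hP; linarith
    have n1 : v ≠ 1 := by rintro rfl; apply hQ; linarith
    have l0 : 0 < v := lt_of_le_of_ne v0 n0.symm
    have l1 : v < 1 := lt_of_le_of_ne v1 n1
    exact opp_of_comb (by linarith : 0 < 1 - v) l0 e hP
  exact ⟨aux u _ _ u0 u1 h1 h2 e1, aux t _ _ t0 t1 h3 h4 e2⟩

lemma mk_mem_seg2 {a b x : Pt} : x ∈ seg2 s(a, b) ↔ x ∈ segment ℝ a b := Iff.rfl

lemma gp_of (S : Finset Pt) (hS : GenPos S) : ∀ a ∈ S, ∀ b ∈ S, ∀ c ∈ S,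
    a ≠ b → a ≠ c → b ≠ c → ori a b c ≠ 0 := fun a ha b hb c hc h1 h2 h3 h =>
  hS a ha b hb c hc h1 h2 h3 (collinear_of_ori h1 h)

lemma meet_end (S : Finset Pt) (hS : GenPos S) {a b c d x : Pt} (ha : a ∈ S) (hb : b ∈ S)
    (hc : c ∈ S) (hd : d ∈ S) (hab : a ≠ b) (hcd : c ≠ d) (hne : s(a, b) ≠ s(c, d))
    (hcr : ¬ Cr a b c d) (h1 : x ∈ segment ℝ a b) (h2 : x ∈ segment ℝ c d) :
    x ∈ s(a, b) ∧ x ∈ s(c, d) := by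
  have gp := gp_of S hS
  simp only [Sym2.mem_iff]
  by_cases e1 : a = c
  · subst e1
    have : b ≠ d := by rintro rfl; exact hne rfl
    have := shared_end (gp a ha b hb d hd hab hcd this) h1 h2
    exact ⟨Or.inl this, Or.inl this⟩
  by_cases e2 : a = d
  · subst e2
    have : b ≠ c := by rintro rfl; exact hne Sym2.eq_swap
    have := shared_end (gp a ha b hb c hc hab hcd.symm this) h1 (by rwa [segment_symm])
    exact ⟨Or.inl this, Or.inr this⟩
  by_cases e3 : b = c
  · subst e3
    have := shared_end (gp b hb a ha d hd hab.symm hcd e2) (by rwa [segment_symm]) h2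
    exact ⟨Or.inr this, Or.inl this⟩
  by_cases e4 : b = d
  · subst e4
    have := shared_end (gp b hb a ha c hc hab.symm hcd.symm e1) (by rwa [segment_symm])
      (by rwa [segment_symm])
    exact ⟨Or.inr this, Or.inr this⟩
  exact absurd (cr_of_meet (gp a ha b hb c hc hab e1 e3) (gp a ha b hb d hd hab e2 e4)
    (gp c hc d hd a ha hcd (Ne.symm e1) (Ne.symm e2)) (gp c hc d hd b hb hcd (Ne.symm e3)
    (Ne.symm e4)) h1 h2) hcr

lemma TG_of {S : Finset Pt} (hS : GenPos S) (T : PlaneGraph S) (hT : IsTriangulation T) :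
    TG S (PAdj T) where
  gp := gp_of S hS
  symm := by intro a b h; unfold PAdj at *; rwa [Sym2.eq_swap]
  ne := by
    intro a b h e
    exact T.not_isDiag _ h (by simpa using e)
  mem := fun {a b} h => T.endpoint_mem _ h a (by simp)
  nc := by
    intro a b c d hab hcd hcr
    have hne : s(a, b) ≠ s(c, d) := by
      intro e
      have h1 := hcr.1
      rw [Sym2.eq_iff] at e
      rcases e with ⟨rfl, rfl⟩ | ⟨rfl, rfl⟩
      · rw [ori_self1] at h1; simp at h1
      · rw [ori_self1] at h1; simp at h1
    obtain ⟨l, t, l0, l1, t0, t1, e⟩ := hcr.pt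
    have hx1 : (1 - l) • a + l • b ∈ segment ℝ a b := seg_mem l0.le l1.le
    have hx2 : (1 - l) • a + l • b ∈ segment ℝ c d := by rw [e]; exact seg_mem t0.le t1.le
    have h := (T.noncrossing _ hab _ hcd hne _ ⟨hx1, hx2⟩).2
    have h1 := hcr.1
    have e0 : ori a b ((1 - l) • a + l • b) = 0 := by
      rw [ori_comb, ori_self1, ori_self2]; ring
    rw [Sym2.mem_iff] at h
    rcases h with h | h
    · rw [h] at e0; rw [e0] at h1; simp at h1
    · rw [h] at e0; rw [e0] at h1; simp at h1
  mx := by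
    intro a ha b hb hab hno
    have hedge : ∀ e ∈ T.edges, s(a, b) ≠ e → ∀ x ∈ seg2 s(a, b) ∩ seg2 e,
        x ∈ s(a, b) ∧ x ∈ e := by
      intro e he hne x hx
      induction e using Sym2.ind with
      | _ c d =>
        exact meet_end S hS ha hb (T.endpoint_mem _ he c (by simp))
          (T.endpoint_mem _ he d (by simp)) hab
          (fun h => T.not_isDiag _ he (by simpa using h)) hne (hno c d he) hx.1 hx.2
    let G : PlaneGraph S :=
      { edges := insert s(a, b) T.edges
        endpoint_mem := by
          intro e he p hp
          rcases Finset.mem_insert.1 he with rfl | he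
          · rcases Sym2.mem_iff.1 hp with rfl | rfl <;> assumption
          · exact T.endpoint_mem e he p hp
        not_isDiag := by
          intro e he
          rcases Finset.mem_insert.1 he with rfl | he
          · simpa using hab
          · exact T.not_isDiag e he
        noncrossing := by
          intro e1 h1 e2 h2 hne x hx
          rcases Finset.mem_insert.1 h1 with rfl | h1 <;>
            rcases Finset.mem_insert.1 h2 with rfl | h2
          · exact absurd rfl hne
          · exact hedge e2 h2 hne x hx
          · exact (hedge e1 h1 hne.symm x hx.symm).symm
          · exact T.noncrossing e1 h1 e2 h2 hne x hx }
    have := hT G (Finset.subset_insert _ _)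
    change s(a, b) ∈ T.edges
    rw [← this]
    exact Finset.mem_insert_self _ _

lemma triFace_of {S : Finset Pt} (T : PlaneGraph S) {a b c : Pt} (h : Fc S (PAdj T) a b c) :
    IsTriFace T a b c := by
  obtain ⟨h1, h2, h3, h4, h5⟩ := h
  have aux : ∀ a b c p : Pt, 0 < ori a b c → ori a b p ≤ 0 →
      p ∉ interior (convexHull ℝ ({a, b, c} : Set Pt)) := by
    intro a b c p hc hp
    apply notin_int (b.2 - a.2) (-(b.1 - a.1))
    · by_contra h
      push Not at h
      unfold ori at hc
      rw [h.1, neg_eq_zero.1 h.2] at hc; simp at hc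
    · intro x hx
      have : 0 ≤ ori a b x := by
        simp only [Set.mem_insert_iff, Set.mem_singleton_iff] at hx
        rcases hx with rfl | rfl | rfl
        · rw [ori_self1]
        · rw [ori_self2]
        · exact hc.le
      unfold ori at this hp
      linarith
  have r1 : ({a, b, c} : Set Pt) = {b, c, a} := by ext; simp; tauto
  have r2 : ({a, b, c} : Set Pt) = {c, a, b} := by ext; simp; tauto
  refine ⟨T.endpoint_mem _ h2 a (by simp), T.endpoint_mem _ h2 b (by simp),
    T.endpoint_mem _ h3 c (by simp), h2, h3, by rw [Sym2.eq_swap]; exact h4, ?_⟩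
  intro p hp
  have := h5 p hp
  by_cases k1 : 0 < ori a b p
  · by_cases k2 : 0 < ori b c p
    · have k3 : ori c a p ≤ 0 := by
        by_contra k; push Not at k; exact this ⟨k1, k2, k⟩
      rw [r2]; exact aux c a b p (by rwa [ori_rot]) k3
    · rw [r1]; exact aux b c a p (by rwa [← ori_rot]) (not_lt.1 k2)
  · exact aux a b c p h1 (not_lt.1 k1)

/-- An edge with two faces is flippable or reflex at one endpoint. -/
lemma flip_or {S : Finset Pt} (T : PlaneGraph S) (hT : TG S (PAdj T)) {a b c d : Pt}
    (h1 : Fc S (PAdj T) a b c) (h2 : Fc S (PAdj T) b a d) :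
    IsFlippable T s(a, b) ∨ Rt S (PAdj T) a b c d ∨ Rt S (PAdj T) b a d c := by
  have hcd : c ≠ d := by
    rintro rfl
    have := h1.1
    have := h2.1
    linarith [ori_swap a b c]
  have n1 := h1.ne hT
  have n2 := h2.ne hT
  have haS := hT.mem h1.2.1
  have hbS := hT.mem h2.2.1
  have hcS := hT.mem h1.2.2.2.1
  have hdS := hT.mem h2.2.2.2.1
  rcases lt_or_gt_of_ne (hT.gp a haS c hcS d hdS n1.2.2.symm n2.2.1 hcd) with k1 | k1
  · rcases lt_or_gt_of_ne (hT.gp b hbS d hdS c hcS n2.2.2.symm n1.2.1 hcd.symm) with k2 | k2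
    · left
      refine ⟨h1.2.1, a, b, c, d, rfl, hcd, triFace_of T h1, ?_, ?_⟩
      · obtain ⟨t1, t2, t3, t4, t5, t6, t7⟩ := triFace_of T h2
        refine ⟨t2, t1, t3, by rwa [Sym2.eq_swap], t6, t5, ?_⟩
        rwa [Set.insert_comm]
      · have hcr : Cr a b c d := by
          refine ⟨mul_neg_of_pos_of_neg h1.1 (by rw [ori_swap]; linarith [h2.1]),
            mul_neg_of_neg_of_pos (by rwa [← ori_rot]) ?_⟩
          rw [← ori_rot, ori_swap']; linarith
        obtain ⟨l, t, l0, l1, t0, t1, e⟩ := hcr.pt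
        exact ⟨(1 - l) • a + l • b, ⟨1 - l, l, by linarith, l0, by ring, rfl⟩,
          ⟨1 - t, t, by linarith, t0, by ring, e.symm⟩⟩
    · right; right
      exact ⟨h2, h1.rot, k2⟩
  · right; left
    exact ⟨h1, h2.rot, k1⟩

lemma rt_int {S adj} (hT : TG S adj) {a b c d : Pt} (h : Rt S adj a b c d) :
    a ∉ frontier (convexHull ℝ (S : Set Pt)) := by
  obtain ⟨f1, f2, h3⟩ := h
  refine not_front S a b c d (hT.mem' f1.2.1) (hT.mem f1.2.2.2.1) (hT.mem' f2.2.1) ?_ ?_ ?_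
  · rw [← ori_rot]; exact f1.1
  · rw [← ori_rot]; exact h3
  · rw [← ori_rot]; exact f2.1
lemma ex_eps (S : Finset Pt) : ∃ ε : ℝ, ∀ p ∈ S, ∀ q ∈ S, p.1 + ε * p.2 = q.1 + ε * q.2 → p = q := by
  obtain ⟨ε, hε⟩ := Infinite.exists_notMem_finset
    ((S ×ˢ S).image (fun x : Pt × Pt => (x.2.1 - x.1.1) / (x.1.2 - x.2.2)))
  refine ⟨ε, fun p hp q hq h => ?_⟩
  by_cases e : p.2 = q.2
  · ext
    · rw [e] at h; linarith
    · exact e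
  · exfalso
    apply hε
    rw [Finset.mem_image]
    refine ⟨(p, q), Finset.mem_product.2 ⟨hp, hq⟩, ?_⟩
    have : p.2 - q.2 ≠ 0 := sub_ne_zero.2 e
    simp only
    rw [div_eq_iff this]
    linarith

/-- the linear functional used for sweeping -/
def Lf (ε : ℝ) (x : Pt) : ℝ := x.1 + ε * x.2

lemma ccw_most {S adj} (hT : TG S adj) (ε : ℝ) (p q : Pt) (hp : p ∈ S) (hq : q ∈ S)
    (h : Lf ε p < Lf ε q) : ∃ r, adj p r ∧ Lf ε p < Lf ε r ∧
      ∀ d, adj p d → Lf ε p < Lf ε d → 0 ≤ ori p d r := by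
  obtain ⟨u, hu, hu'⟩ := hT.vis 1 ε p q hp hq (by unfold Lf at h; linarith)
  obtain ⟨r, hr, hmin⟩ := exists_first (-1) p (p.1 - ε, p.2 + 1)
    (S.filter (fun x => adj p x ∧ Lf ε p < Lf ε x))
    ⟨u, by rw [Finset.mem_filter]; exact ⟨hT.mem' hu, hu, by unfold Lf; linarith⟩⟩
    (by
      intro x hx
      rw [Finset.mem_filter] at hx
      have := hx.2.2
      unfold Lf at this
      simp only [ori]
      linarith)
  rw [Finset.mem_filter] at hr
  refine ⟨r, hr.2.1, hr.2.2, fun d hd hd' => ?_⟩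
  have := hmin d (by rw [Finset.mem_filter]; exact ⟨hT.mem' hd, hd, hd'⟩)
  linarith

lemma cw_most {S adj} (hT : TG S adj) (ε : ℝ) (p q : Pt) (hp : p ∈ S) (hq : q ∈ S)
    (h : Lf ε p < Lf ε q) : ∃ r, adj p r ∧ Lf ε p < Lf ε r ∧
      ∀ d, adj p d → Lf ε p < Lf ε d → ori p d r ≤ 0 := by
  obtain ⟨u, hu, hu'⟩ := hT.vis 1 ε p q hp hq (by unfold Lf at h; linarith)
  obtain ⟨r, hr, hmin⟩ := exists_first 1 p (p.1 + ε, p.2 - 1)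
    (S.filter (fun x => adj p x ∧ Lf ε p < Lf ε x))
    ⟨u, by rw [Finset.mem_filter]; exact ⟨hT.mem' hu, hu, by unfold Lf; linarith⟩⟩
    (by
      intro x hx
      rw [Finset.mem_filter] at hx
      have := hx.2.2
      unfold Lf at this
      simp only [ori]
      linarith)
  rw [Finset.mem_filter] at hr
  refine ⟨r, hr.2.1, hr.2.2, fun d hd hd' => ?_⟩
  have := hmin d (by rw [Finset.mem_filter]; exact ⟨hT.mem' hd, hd, hd'⟩)
  linarith

/-- triples forming a face whose third vertex is the middle one in the sweep order -/
def MidT (S : Finset Pt) (adj : Pt → Pt → Prop) (ε : ℝ) (a b p : Pt) : Prop :=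
  Fc S adj a b p ∧ ((Lf ε a < Lf ε p ∧ Lf ε p < Lf ε b) ∨ (Lf ε b < Lf ε p ∧ Lf ε p < Lf ε a))

lemma mid_up {S adj} (hT : TG S adj) (ε : ℝ)
    (hε : ∀ p ∈ S, ∀ q ∈ S, Lf ε p = Lf ε q → p = q) {p r q : Pt} (hr : adj p r)
    (hr' : Lf ε p < Lf ε r) (hm : ∀ d, adj p d → Lf ε p < Lf ε d → 0 ≤ ori p d r)
    (hq : q ∈ S) (h : 0 < ori p r q) :
    ∃ a b, MidT S adj ε a b p ∧ ¬ Lf ε a < Lf ε p := by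
  obtain ⟨c, hc⟩ := hT.face p r q hr hq h
  have hpc := hT.symm hc.2.2.2.1
  have : Lf ε c < Lf ε p := by
    by_contra hcon
    push Not at hcon
    have hlt := lt_of_le_of_ne hcon
      (fun e => hT.ne hpc (hε p (hT.mem hpc) c (hT.mem' hpc) e))
    have h1 := hm c hpc hlt
    have h2 := hc.1
    rw [ori_swap'] at h1
    linarith
  exact ⟨r, c, ⟨hc.rot, Or.inr ⟨this, hr'⟩⟩, not_lt.2 hr'.le⟩

lemma mid_dn {S adj} (hT : TG S adj) (ε : ℝ)
    (hε : ∀ p ∈ S, ∀ q ∈ S, Lf ε p = Lf ε q → p = q) {p r q : Pt} (hr : adj p r)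
    (hr' : Lf ε p < Lf ε r) (hm : ∀ d, adj p d → Lf ε p < Lf ε d → ori p d r ≤ 0)
    (hq : q ∈ S) (h : 0 < ori r p q) :
    ∃ a b, MidT S adj ε a b p ∧ Lf ε a < Lf ε p := by
  obtain ⟨c, hc⟩ := hT.face r p q (hT.symm hr) hq h
  have hpc := hc.2.2.1
  have : Lf ε c < Lf ε p := by
    by_contra hcon
    push Not at hcon
    have hlt := lt_of_le_of_ne hcon
      (fun e => hT.ne hpc (hε p (hT.mem hpc) c (hT.mem' hpc) e))
    have h1 := hm c hpc hlt
    have h2 := hc.1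
    rw [ori_rot] at h2
    linarith
  exact ⟨c, r, ⟨hc.rot.rot, Or.inl ⟨this, hr'⟩⟩, this⟩

lemma mid_int {S adj} (hT : TG S adj) (ε : ℝ)
    (hε : ∀ p ∈ S, ∀ q ∈ S, Lf ε p = Lf ε q → p = q) {p : Pt} (hp : p ∈ S)
    (hi : p ∉ frontier (convexHull ℝ (S : Set Pt))) :
    (∃ a b, MidT S adj ε a b p ∧ ¬ Lf ε a < Lf ε p) ∧
    (∃ a b, MidT S adj ε a b p ∧ Lf ε a < Lf ε p) := by
  have hq : ∃ q ∈ S, Lf ε p < Lf ε q := by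
    by_contra hcon
    push Not at hcon
    refine hi (front_of_max 1 ε S p hp (Or.inl one_ne_zero) ?_)
    intro x hx
    have := hcon x hx
    unfold Lf at this; linarith
  obtain ⟨q, hq, hpq⟩ := hq
  constructor
  · obtain ⟨r, h1, h2, h3⟩ := ccw_most hT ε p q hp hq hpq
    obtain ⟨w, hw, hw'⟩ := left_of_int S p r hp (hT.ne h1) hi
    exact mid_up hT ε hε h1 h2 h3 hw hw'
  · obtain ⟨r, h1, h2, h3⟩ := cw_most hT ε p q hp hq hpq
    obtain ⟨w, hw, hw'⟩ := right_of_int S p r hp (hT.ne h1) hi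
    exact mid_dn hT ε hε h1 h2 h3 hw hw'

lemma mid_hull {S adj} (hT : TG S adj) (ε : ℝ)
    (hε : ∀ p ∈ S, ∀ q ∈ S, Lf ε p = Lf ε q → p = q) {p q l : Pt} (hp : p ∈ S)
    (hq : q ∈ S) (hpq : Lf ε p < Lf ε q) (hl : l ∈ S) (hpl : Lf ε l < Lf ε p) :
    (∃ a b, MidT S adj ε a b p ∧ ¬ Lf ε a < Lf ε p) ∨
    (∃ a b, MidT S adj ε a b p ∧ Lf ε a < Lf ε p) := by
  obtain ⟨r, h1, h2, h3⟩ := ccw_most hT ε p q hp hq hpq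
  obtain ⟨r', k1, k2, k3⟩ := cw_most hT ε p q hp hq hpq
  by_cases hA : 0 < ori p r l
  · exact Or.inl (mid_up hT ε hε h1 h2 h3 hl hA)
  by_cases hB : 0 < ori r' p l
  · exact Or.inr (mid_dn hT ε hε k1 k2 k3 hl hB)
  exfalso
  push Not at hA hB
  have hrl : r ≠ l := by rintro rfl; linarith
  have hpl' : p ≠ l := by rintro rfl; linarith
  have g := hT.gp p hp r (hT.mem' h1) l hl (hT.ne h1) hpl' hrl
  have hA' : ori p r l < 0 := lt_of_le_of_ne hA g
  have hC := h3 r' k1 k2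
  have id : (Lf ε l - Lf ε p) * ori p r' r + (Lf ε r' - Lf ε p) * ori p r l +
      (Lf ε r - Lf ε p) * ori r' p l = 0 := by
    unfold Lf ori; ring
  have t1 : (Lf ε l - Lf ε p) * ori p r' r ≤ 0 :=
    mul_nonpos_of_nonpos_of_nonneg (by linarith) hC
  have t2 : (Lf ε r' - Lf ε p) * ori p r l < 0 := mul_neg_of_pos_of_neg (by linarith) hA'
  have t3 : (Lf ε r - Lf ε p) * ori r' p l ≤ 0 := mul_nonpos_of_nonneg_of_nonpos (by linarith) hB
  linarith

/-- darts having a point on the left -/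
def Dl (S : Finset Pt) (adj : Pt → Pt → Prop) : Finset (Pt × Pt) :=
  (S ×ˢ S).filter (fun x => adj x.1 x.2 ∧ ∃ q ∈ S, 0 < ori x.1 x.2 q)

def Pm (S : Finset Pt) (adj : Pt → Pt → Prop) (ε : ℝ) : Finset (Pt × Pt × Pt) :=
  (S ×ˢ S ×ˢ S).filter (fun x => MidT S adj ε x.1 x.2.1 x.2.2)

def Hl (S : Finset Pt) : Finset Pt :=
  S.filter (fun p => p ∈ frontier (convexHull ℝ (S : Set Pt)))

def In (S : Finset Pt) : Finset Pt :=
  S.filter (fun p => p ∉ frontier (convexHull ℝ (S : Set Pt)))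

lemma Pm_mem {S adj ε} (hT : TG S adj) {a b c : Pt} :
    (a, b, c) ∈ Pm S adj ε ↔ MidT S adj ε a b c := by
  unfold Pm
  rw [Finset.mem_filter]
  simp only [Finset.mem_product]
  constructor
  · exact fun h => h.2
  · intro h
    exact ⟨⟨hT.mem h.1.2.1, hT.mem' h.1.2.1, hT.mem h.1.2.2.2.1⟩, h⟩

lemma mid_card {S adj} (hT : TG S adj) (ε : ℝ)
    (hε : ∀ p ∈ S, ∀ q ∈ S, Lf ε p = Lf ε q → p = q) (hH : (Hl S).card = 3) :
    2 * (In S).card + 1 ≤ (Pm S adj ε).card := by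
  have hsub : ∀ x ∈ Hl S, x ∈ S := fun x hx => (Finset.mem_filter.1 hx).1
  have hne : (Hl S).Nonempty := by rw [← Finset.card_pos]; omega
  obtain ⟨M, hM, hMm⟩ := (Hl S).exists_max_image (Lf ε) hne
  obtain ⟨m, hm, hmm⟩ := (Hl S).exists_min_image (Lf ε) hne
  obtain ⟨h2, hh2, hh2'⟩ : ∃ h2 ∈ Hl S, h2 ∉ ({M, m} : Finset Pt) := by
    by_contra hcon
    push Not at hcon
    have := Finset.card_le_card (show Hl S ⊆ {M, m} from hcon)
    have := Finset.card_le_two (a := M) (b := m)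
    omega
  simp only [Finset.mem_insert, Finset.mem_singleton, not_or] at hh2'
  have l1 : Lf ε h2 < Lf ε M := lt_of_le_of_ne (hMm h2 hh2)
    (fun e => hh2'.1 (hε _ (hsub _ hh2) _ (hsub _ hM) e))
  have l2 : Lf ε m < Lf ε h2 := lt_of_le_of_ne (hmm h2 hh2)
    (fun e => hh2'.2 (hε _ (hsub _ hh2) _ (hsub _ hm) e.symm))
  have key : ∃ β : Bool, ∃ a b, MidT S adj ε a b h2 ∧ decide (Lf ε a < Lf ε h2) = β := by
    rcases mid_hull hT ε hε (hsub _ hh2) (hsub _ hM) l1 (hsub _ hm) l2 with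
      ⟨a, b, h, h'⟩ | ⟨a, b, h, h'⟩
    · exact ⟨false, a, b, h, by simpa using h'⟩
    · exact ⟨true, a, b, h, by simpa using h'⟩
  obtain ⟨β, a0, b0, hab0, hβ⟩ := key
  have hcard : (insert (h2, β) (In S ×ˢ (Finset.univ : Finset Bool))).card =
      2 * (In S).card + 1 := by
    rw [Finset.card_insert_of_notMem, Finset.card_product]
    · simp; ring
    · intro h
      have h1 := (Finset.mem_product.1 h).1
      exact (Finset.mem_filter.1 h1).2 (Finset.mem_filter.1 hh2).2
  rw [← hcard]
  apply Finset.card_le_card_of_surjOn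
    (fun x : Pt × Pt × Pt => (x.2.2, decide (Lf ε x.1 < Lf ε x.2.2)))
  rintro ⟨p, γ⟩ hx
  have hx := Finset.mem_coe.1 hx
  rcases Finset.mem_insert.1 hx with hx | hx
  · obtain ⟨rfl, rfl⟩ := Prod.mk.inj hx
    exact ⟨(a0, b0, p), Finset.mem_coe.2 ((Pm_mem hT).2 hab0), by simp only [hβ]⟩
  · have hp := (Finset.mem_product.1 hx).1
    have hp' := Finset.mem_filter.1 hp
    obtain ⟨⟨a, b, h, h'⟩, ⟨a', b', k, k'⟩⟩ := mid_int hT ε hε hp'.1 hp'.2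
    cases γ
    · exact ⟨(a, b, p), Finset.mem_coe.2 ((Pm_mem hT).2 h), by simpa using h'⟩
    · exact ⟨(a', b', p), Finset.mem_coe.2 ((Pm_mem hT).2 k), by simpa using k'⟩

lemma Fc_Dl {S adj} (hT : TG S adj) {a b c : Pt} (h : Fc S adj a b c) : (a, b) ∈ Dl S adj := by
  unfold Dl
  rw [Finset.mem_filter]
  exact ⟨Finset.mem_product.2 ⟨hT.mem h.2.1, hT.mem' h.2.1⟩, h.2.1, c, hT.mem h.2.2.2.1, h.1⟩

lemma dl_card {S adj} (hT : TG S adj) (ε : ℝ) : 3 * (Pm S adj ε).card ≤ (Dl S adj).card := by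
  let g1 : Pt × Pt × Pt → Pt × Pt := fun x => (x.1, x.2.1)
  let g2 : Pt × Pt × Pt → Pt × Pt := fun x => (x.2.1, x.2.2)
  let g3 : Pt × Pt × Pt → Pt × Pt := fun x => (x.2.2, x.1)
  have c1 : ((Pm S adj ε).image g1).card = (Pm S adj ε).card := by
    apply Finset.card_image_of_injOn
    rintro ⟨a, b, c⟩ h ⟨a', b', c'⟩ h' e
    have h := (Pm_mem hT).1 (Finset.mem_coe.1 h)
    have h' := (Pm_mem hT).1 (Finset.mem_coe.1 h')
    obtain ⟨rfl, rfl⟩ := Prod.mk.inj e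
    rw [hT.uniq h.1 h'.1]
  have c2 : ((Pm S adj ε).image g2).card = (Pm S adj ε).card := by
    apply Finset.card_image_of_injOn
    rintro ⟨a, b, c⟩ h ⟨a', b', c'⟩ h' e
    have h := (Pm_mem hT).1 (Finset.mem_coe.1 h)
    have h' := (Pm_mem hT).1 (Finset.mem_coe.1 h')
    obtain ⟨rfl, rfl⟩ := Prod.mk.inj e
    rw [hT.uniq h.1.rot h'.1.rot]
  have c3 : ((Pm S adj ε).image g3).card = (Pm S adj ε).card := by
    apply Finset.card_image_of_injOn
    rintro ⟨a, b, c⟩ h ⟨a', b', c'⟩ h' e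
    have h := (Pm_mem hT).1 (Finset.mem_coe.1 h)
    have h' := (Pm_mem hT).1 (Finset.mem_coe.1 h')
    obtain ⟨rfl, rfl⟩ := Prod.mk.inj e
    rw [hT.uniq h.1.rot.rot h'.1.rot.rot]
  have d12 : Disjoint ((Pm S adj ε).image g1) ((Pm S adj ε).image g2) := by
    rw [Finset.disjoint_left]
    intro x hx hx'
    obtain ⟨⟨a, b, c⟩, h, rfl⟩ := Finset.mem_image.1 hx
    obtain ⟨⟨a', b', c'⟩, h', e⟩ := Finset.mem_image.1 hx'
    have h := (Pm_mem hT).1 h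
    have h' := (Pm_mem hT).1 h'
    obtain ⟨rfl, rfl⟩ := Prod.mk.inj e
    have := hT.uniq h.1 h'.1.rot
    try simp only at this
    subst this
    have m1 := h.2
    have m2 := h'.2
    try simp only at m1 m2
    rcases m1 with ⟨_, _⟩ | ⟨_, _⟩ <;> rcases m2 with ⟨_, _⟩ | ⟨_, _⟩ <;> linarith
  have d13 : Disjoint ((Pm S adj ε).image g1) ((Pm S adj ε).image g3) := by
    rw [Finset.disjoint_left]
    intro x hx hx'
    obtain ⟨⟨a, b, c⟩, h, rfl⟩ := Finset.mem_image.1 hx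
    obtain ⟨⟨a', b', c'⟩, h', e⟩ := Finset.mem_image.1 hx'
    have h := (Pm_mem hT).1 h
    have h' := (Pm_mem hT).1 h'
    obtain ⟨rfl, rfl⟩ := Prod.mk.inj e
    have := hT.uniq h.1 h'.1.rot.rot
    try simp only at this
    subst this
    have m1 := h.2
    have m2 := h'.2
    try simp only at m1 m2
    rcases m1 with ⟨_, _⟩ | ⟨_, _⟩ <;> rcases m2 with ⟨_, _⟩ | ⟨_, _⟩ <;> linarith
  have d23 : Disjoint ((Pm S adj ε).image g2) ((Pm S adj ε).image g3) := by
    rw [Finset.disjoint_left]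
    intro x hx hx'
    obtain ⟨⟨a, b, c⟩, h, rfl⟩ := Finset.mem_image.1 hx
    obtain ⟨⟨a', b', c'⟩, h', e⟩ := Finset.mem_image.1 hx'
    have h := (Pm_mem hT).1 h
    have h' := (Pm_mem hT).1 h'
    obtain ⟨rfl, rfl⟩ := Prod.mk.inj e
    have := hT.uniq h.1.rot h'.1.rot.rot
    try simp only at this
    subst this
    have m1 := h.2
    have m2 := h'.2
    try simp only at m1 m2
    rcases m1 with ⟨_, _⟩ | ⟨_, _⟩ <;> rcases m2 with ⟨_, _⟩ | ⟨_, _⟩ <;> linarith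
  have hsub : ((Pm S adj ε).image g1 ∪ (Pm S adj ε).image g2) ∪ (Pm S adj ε).image g3 ⊆
      Dl S adj := by
    intro x hx
    rw [Finset.mem_union, Finset.mem_union] at hx
    rcases hx with (hx | hx) | hx
    all_goals
      obtain ⟨⟨a, b, c⟩, h, rfl⟩ := Finset.mem_image.1 hx
      have h := ((Pm_mem hT).1 h).1
    · exact Fc_Dl hT h
    · exact Fc_Dl hT h.rot
    · exact Fc_Dl hT h.rot.rot
  have := Finset.card_le_card hsub
  rw [Finset.card_union_of_disjoint (Finset.disjoint_union_left.2 ⟨d13, d23⟩),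
    Finset.card_union_of_disjoint d12, c1, c2, c3] at this
  omega

/-- darts having points on both sides -/
def Di (S : Finset Pt) (adj : Pt → Pt → Prop) : Finset (Pt × Pt) :=
  (S ×ˢ S).filter (fun x => adj x.1 x.2 ∧ (∃ q ∈ S, 0 < ori x.1 x.2 q) ∧
    ∃ q ∈ S, 0 < ori x.2 x.1 q)

lemma di_card {S adj} (hT : TG S adj) (hH : (Hl S).card = 3) :
    (Dl S adj).card ≤ (Di S adj).card + 3 := by
  have hsub : Di S adj ⊆ Dl S adj := by
    intro x hx
    obtain ⟨h1, h2, h3, _⟩ := Finset.mem_filter.1 hx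
    exact Finset.mem_filter.2 ⟨h1, h2, h3⟩
  have hc := Finset.card_sdiff_add_card_eq_card hsub
  have key : ∀ x ∈ Dl S adj \ Di S adj, adj x.1 x.2 ∧ x.1 ∈ S ∧ x.2 ∈ S ∧
      (∃ q ∈ S, 0 < ori x.1 x.2 q) ∧ ¬ ∃ q ∈ S, 0 < ori x.2 x.1 q := by
    intro x hx
    rw [Finset.mem_sdiff] at hx
    obtain ⟨h1, h2, h3⟩ := Finset.mem_filter.1 hx.1
    refine ⟨h2, (Finset.mem_product.1 h1).1, (Finset.mem_product.1 h1).2, h3, fun h => hx.2 ?_⟩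
    exact Finset.mem_filter.2 ⟨h1, h2, h3, h⟩
  have hs : (Dl S adj \ Di S adj) ∪ (Dl S adj \ Di S adj).image Prod.swap ⊆ (Hl S).offDiag := by
    have k1 : ∀ x ∈ Dl S adj \ Di S adj, x.1 ∈ Hl S ∧ x.2 ∈ Hl S ∧ x.1 ≠ x.2 := by
      intro x hx
      obtain ⟨h1, h2, h3, _, h4⟩ := key x hx
      refine ⟨Finset.mem_filter.2 ⟨h2, ?_⟩, Finset.mem_filter.2 ⟨h3, ?_⟩, hT.ne h1⟩
      · by_contra hc
        exact h4 (right_of_int S x.1 x.2 h2 (hT.ne h1) hc)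
      · by_contra hc
        exact h4 (left_of_int S x.2 x.1 h3 (hT.ne h1).symm hc)
    intro x hx
    rw [Finset.mem_offDiag]
    rcases Finset.mem_union.1 hx with hx | hx
    · exact k1 x hx
    · obtain ⟨y, hy, rfl⟩ := Finset.mem_image.1 hx
      obtain ⟨a, b, c⟩ := k1 y hy
      exact ⟨b, a, c.symm⟩
  have hd : Disjoint (Dl S adj \ Di S adj) ((Dl S adj \ Di S adj).image Prod.swap) := by
    rw [Finset.disjoint_left]
    intro x hx hx'
    obtain ⟨y, hy, rfl⟩ := Finset.mem_image.1 hx'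
    exact (key y hy).2.2.2.2 (key _ hx).2.2.2.1
  have h6 := Finset.card_le_card hs
  rw [Finset.card_union_of_disjoint hd, Finset.card_image_of_injective _ Prod.swap_injective,
    Finset.offDiag_card, hH] at h6
  omega

def Rf (S : Finset Pt) (adj : Pt → Pt → Prop) : Finset (Pt × Pt) :=
  (S ×ˢ S).filter (fun x => ∃ c d, Rt S adj x.1 x.2 c d)

lemma rf_at {S : Finset Pt} (T : PlaneGraph S) (hT : TG S (PAdj T)) (a : Pt) :
    ((Rf S (PAdj T)).filter (fun x => x.1 = a)).card ≤ 2 + (if degree T a = 3 then 1 else 0) := by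
  by_cases h : 2 < ((Rf S (PAdj T)).filter (fun x => x.1 = a)).card
  · obtain ⟨⟨a1, b1⟩, ⟨a2, b2⟩, ⟨a3, b3⟩, m1, m2, m3, n12, n13, n23⟩ := Finset.two_lt_card_iff.1 h
    obtain ⟨k1, rfl⟩ := Finset.mem_filter.1 m1
    obtain ⟨k2, e2⟩ := Finset.mem_filter.1 m2
    obtain ⟨k3, e3⟩ := Finset.mem_filter.1 m3
    simp only at e2 e3
    subst e2 e3
    obtain ⟨_, c1, d1, r1⟩ := Finset.mem_filter.1 k1
    obtain ⟨_, c2, d2, r2⟩ := Finset.mem_filter.1 k2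
    obtain ⟨_, c3, d3, r3⟩ := Finset.mem_filter.1 k3
    try simp only at r1 r2 r3
    have n12 : b1 ≠ b2 := by rintro rfl; exact n12 rfl
    have n13 : b1 ≠ b3 := by rintro rfl; exact n13 rfl
    have n23 : b2 ≠ b3 := by rintro rfl; exact n23 rfl
    have all : ∀ e, PAdj T a3 e → e = b1 ∨ e = b2 ∨ e = b3 :=
      fun e he => hT.rt_three r1 r2 r3 n12 n13 n23 he
    have c3 : ({b1, b2, b3} : Finset Pt).card = 3 := Finset.card_eq_three.2
      ⟨b1, b2, b3, n12, n13, n23, rfl⟩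
    have hdeg : degree T a3 = 3 := by
      unfold degree
      have : T.edges.filter (fun e => a3 ∈ e) = ({b1, b2, b3} : Finset Pt).image (fun b => s(a3, b)) := by
        ext e
        rw [Finset.mem_filter, Finset.mem_image]
        constructor
        · rintro ⟨h1, h2⟩
          obtain ⟨b, rfl⟩ := h2
          refine ⟨b, ?_, rfl⟩
          simpa using all b h1
        · rintro ⟨b, hb, rfl⟩
          simp only [Finset.mem_insert, Finset.mem_singleton] at hb
          refine ⟨?_, by simp⟩
          rcases hb with rfl | rfl | rfl
          · exact r1.1.2.1
          · exact r2.1.2.1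
          · exact r3.1.2.1
      rw [this, Finset.card_image_of_injective _ (fun x y h => Sym2.congr_right.1 h), c3]
    rw [if_pos hdeg]
    change ((Rf S (PAdj T)).filter (fun x => x.1 = a3)).card ≤ _
    have hsub : (Rf S (PAdj T)).filter (fun x => x.1 = a3) ⊆
        ({b1, b2, b3} : Finset Pt).image (fun b => (a3, b)) := by
      rintro ⟨x, y⟩ hx
      obtain ⟨kx, e⟩ := Finset.mem_filter.1 hx
      simp only at e
      subst e
      obtain ⟨_, c, d, r⟩ := Finset.mem_filter.1 kx
      rw [Finset.mem_image]
      refine ⟨y, ?_, rfl⟩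
      simpa using all y r.1.2.1
    have h1 := Finset.card_le_card hsub
    have h2 := Finset.card_image_le (s := ({b1, b2, b3} : Finset Pt)) (f := fun b => (a3, b))
    omega
  · omega

lemma rf_card {S : Finset Pt} (T : PlaneGraph S) (hT : TG S (PAdj T)) :
    (Rf S (PAdj T)).card ≤ 2 * (In S).card + v3 T := by
  have hm : ∀ x ∈ Rf S (PAdj T), x.1 ∈ In S := by
    intro x hx
    obtain ⟨h1, c, d, h⟩ := Finset.mem_filter.1 hx
    exact Finset.mem_filter.2 ⟨(Finset.mem_product.1 h1).1, rt_int hT h⟩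
  rw [Finset.card_eq_sum_card_fiberwise hm]
  refine (Finset.sum_le_sum (fun a _ => rf_at T hT a)).trans ?_
  rw [Finset.sum_add_distrib, Finset.sum_const, smul_eq_mul, ← Finset.card_filter, mul_comm]
  unfold v3 In
  rw [Finset.filter_filter]

lemma flip_card {S : Finset Pt} (T : PlaneGraph S) (hT : TG S (PAdj T)) :
    (Di S (PAdj T)).card ≤ 2 * flipCount T + 2 * (Rf S (PAdj T)).card := by
  have hsub : Di S (PAdj T) ⊆ ((Di S (PAdj T)).filter (fun x => IsFlippable T s(x.1, x.2)) ∪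
      Rf S (PAdj T)) ∪ (Rf S (PAdj T)).image Prod.swap := by
    rintro ⟨a, b⟩ hx
    obtain ⟨h1, h2, ⟨q, hq, hq'⟩, ⟨r, hr, hr'⟩⟩ := Finset.mem_filter.1 hx
    simp only at h2 hq' hr'
    have hab := Finset.mem_product.1 h1
    obtain ⟨c, hc⟩ := hT.face a b q h2 hq hq'
    obtain ⟨d, hd⟩ := hT.face b a r (hT.symm h2) hr hr'
    rw [Finset.mem_union, Finset.mem_union]
    rcases flip_or T hT hc hd with h | h | h
    · exact Or.inl (Or.inl (Finset.mem_filter.2 ⟨hx, h⟩))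
    · exact Or.inl (Or.inr (Finset.mem_filter.2 ⟨h1, c, d, h⟩))
    · refine Or.inr (Finset.mem_image.2 ⟨(b, a), Finset.mem_filter.2
        ⟨Finset.mem_product.2 ⟨hab.2, hab.1⟩, d, c, h⟩, rfl⟩)
  have hF : ((Di S (PAdj T)).filter (fun x => IsFlippable T s(x.1, x.2))).card ≤
      2 * flipCount T := by
    unfold flipCount
    apply Finset.card_le_mul_card_image_of_maps_to (f := fun x : Pt × Pt => s(x.1, x.2))
    · intro x hx
      have := (Finset.mem_filter.1 hx).2
      exact Finset.mem_filter.2 ⟨this.1, this⟩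
    · intro e he
      induction e using Sym2.ind with
      | _ c d =>
        refine (Finset.card_le_card (t := {(c, d), (d, c)}) ?_).trans Finset.card_le_two
        rintro ⟨a, b⟩ hx
        have := (Finset.mem_filter.1 hx).2
        simpa using this
  have h1 := Finset.card_le_card hsub
  have h2 := Finset.card_union_le ((Di S (PAdj T)).filter (fun x => IsFlippable T s(x.1, x.2)) ∪
      Rf S (PAdj T)) ((Rf S (PAdj T)).image Prod.swap)
  have h3 := Finset.card_union_le ((Di S (PAdj T)).filter (fun x => IsFlippable T s(x.1, x.2)))
      (Rf S (PAdj T))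
  have h4 := Finset.card_image_le (s := Rf S (PAdj T)) (f := Prod.swap)
  omega

/-- for a triangulation of a point set with a triangular convex
hull, `flip(T) ≥ N - 3 - v₃(T)`. -/
theorem statement19 (S : Finset Pt) (hS : GenPos S) (hhull : hullVtxCount S = 3)
    (T : PlaneGraph S) (hT : IsTriangulation T) :
    (S.card : ℝ) - 3 - (v3 T : ℝ) ≤ (flipCount T : ℝ) := by
  have tg := TG_of hS T hT
  have hH : (Hl S).card = 3 := hhull
  have hN : (Hl S).card + (In S).card = S.card :=
    Finset.card_filter_add_card_filter_not _
  obtain ⟨ε, hε⟩ := ex_eps S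
  have h1 := mid_card tg ε hε hH
  have h2 := dl_card tg ε
  have h3 := di_card tg hH
  have h4 := flip_card T tg
  have h5 := rf_card T tg
  have h6 : S.card ≤ flipCount T + 3 + v3 T := by omega
  have h7 : (S.card : ℝ) ≤ (flipCount T : ℝ) + 3 + (v3 T : ℝ) := by exact_mod_cast h6
  linarith

end
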